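/- arXiv:1512.06509 — 5 statements merged into one kernel-verified Lean document; each statement's English description precedes it below -/
import Mathlib

section
/- Let f : B_1 → ℝ be bounded and let u : ℝ^n → ℝ be a bounded classical solution of L u = f in the unit ball B_1 ⊂ ℝ^n. Then there exists a constant C > 0, depending only on a_1, …, a_m, s_1, …, s_{m-1} and N_1, …, N_{m-1}, such that sup_{x ∈ B_{1/2}} |∂_{x_n} u(x)| ≤ C · ( ‖f‖_{L^∞(B_1)} + ‖u‖_{L^∞(ℝ^n)} ). -/
open MeasureTheory Real Filter

noncomputable section

/-- The normalization constant `c_{N,s}`. -/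
def cns (N : ℕ) (s : ℝ) : ℝ :=
  2 ^ (2 * s - 1) * Real.Gamma (s + (N : ℝ) / 2) /
    (Real.pi ^ ((N : ℝ) / 2) * |Real.Gamma (-s)|)

/-- The constant `η_i`. -/
def etaC (N : ℕ) (s : ℝ) : ℝ :=
  Real.Gamma ((N : ℝ) / 2) /
    (2 ^ (2 * s) * Real.Gamma (s + 1) * Real.Gamma (s + (N : ℝ) / 2))

/-- `ℝ^n` with coordinates grouped according to `N : ι → ℕ`. -/
abbrev GS {ι : Type*} (N : ι → ℕ) : Type _ :=
  PiLp 2 (fun i : ι => EuclideanSpace ℝ (Fin (N i)))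

/-- The inclusion `y ↦ y^{(i)}`. -/
def grpIncl {ι : Type*} [DecidableEq ι] (N : ι → ℕ) (i : ι)
    (y : EuclideanSpace ℝ (Fin (N i))) : GS N :=
  WithLp.toLp 2 (Pi.single i y)

/-- Second derivative of `u` at `x` in direction `v`. -/
def dirD2 {E : Type*} [NormedAddCommGroup E] [NormedSpace ℝ E]
    (u : E → ℝ) (x v : E) : ℝ :=
  iteratedDeriv 2 (fun t : ℝ => u (x + t • v)) 0

/-- The operator `(-Δ_{X_i})^{s_i}`. -/
def gLap {ι : Type*} [Fintype ι] [DecidableEq ι] (N : ι → ℕ) (i : ι) (si : ℝ)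
    (u : GS N → ℝ) (x : GS N) : ℝ :=
  if si = 1 then
    -∑ j : Fin (N i), dirD2 u x (grpIncl N i (EuclideanSpace.single j 1))
  else
    cns (N i) si *
      ∫ y : EuclideanSpace ℝ (Fin (N i)),
        (2 * u x - u (x + grpIncl N i y) - u (x - grpIncl N i y)) /
          ‖y‖ ^ ((N i : ℝ) + 2 * si)

/-- Absolute convergence of the integral defining `(-Δ_{X_i})^{s_i} u (x)`
(trivial in the local case `s_i = 1`). -/
def gInt {ι : Type*} [Fintype ι] [DecidableEq ι] (N : ι → ℕ) (i : ι) (si : ℝ)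
    (u : GS N → ℝ) (x : GS N) : Prop :=
  si = 1 ∨ Integrable (fun y : EuclideanSpace ℝ (Fin (N i)) =>
    (2 * u x - u (x + grpIncl N i y) - u (x - grpIncl N i y)) /
      ‖y‖ ^ ((N i : ℝ) + 2 * si))

/-- The operator `L = Σ_i a_i (-Δ_{X_i})^{s_i}`. -/
def Lop {ι : Type*} [Fintype ι] [DecidableEq ι] (N : ι → ℕ) (a s : ι → ℝ)
    (u : GS N → ℝ) (x : GS N) : ℝ :=
  ∑ i, a i * gLap N i (s i) u x

/-- `u` is a classical solution of `L u = f` in `Ω`. -/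
def IsSol {ι : Type*} [Fintype ι] [DecidableEq ι] (N : ι → ℕ) (a s : ι → ℝ)
    (u f : GS N → ℝ) (Ω : Set (GS N)) : Prop :=
  Continuous u ∧ ∀ x ∈ Ω, ContDiffAt ℝ 2 u x ∧ (∀ i, gInt N i (s i) u x) ∧
    Lop N a s u x = f x

/-- The unit vector `e_n` (the last group has one coordinate). -/
def eN {m : ℕ} (N : Fin (m + 1) → ℕ) : GS N :=
  grpIncl N (Fin.last m) (WithLp.toLp 2 (fun _ => (1 : ℝ)))

/-- The box `Q_{d,κ}`. -/
def Qset {m : ℕ} (N : Fin (m + 1) → ℕ) (d : Fin (m + 1) → ℝ) (κ : ℝ) :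
    Set (GS N) :=
  {x | (∀ i, i ≠ Fin.last m → ‖x i‖ < d i) ∧
    ‖x (Fin.last m)‖ < κ * d (Fin.last m)}

/-- The cube `(-c,c)^n`. -/
def gCube {m : ℕ} (N : Fin (m + 1) → ℕ) (c : ℝ) : Set (GS N) :=
  {x | ∀ (i : Fin (m + 1)) (j : Fin (N i)), |x i j| < c}

/-- `ℋ^{N-1}(S^{N-1})`. -/
def sphVol (n : ℕ) : ℝ :=
  (μH[(n : ℝ) - 1] (Metric.sphere (0 : EuclideanSpace ℝ (Fin n)) 1)).toReal

/-- The operator `L_*` acting on functions of `(x,t) ∈ ℝ^n × ℝ`. -/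
def LstarOp {m : ℕ} (N : Fin (m + 1) → ℕ) (a s : Fin (m + 1) → ℝ) (ν : ℝ)
    (h : GS N × ℝ → ℝ) (p : GS N × ℝ) : ℝ :=
  (∑ i ∈ Finset.univ.erase (Fin.last m),
      a i * gLap N i (s i) (fun z => h (z, p.2)) p.1)
    - (a (Fin.last m) - ν) * dirD2 (fun z => h (z, p.2)) p.1 (eN N)
    - ν * dirD2 (fun τ : ℝ => h (p.1, τ)) p.2 1

/-- The barrier `Φ`. -/
def PhiBar {m : ℕ} (N : Fin (m + 1) → ℕ) (s d : Fin (m + 1) → ℝ)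
    (ν A₁ A₂ : ℝ) (p : GS N × ℝ) : ℝ :=
  A₁ / ν * (max p.2 0 * max (d (Fin.last m) - p.2) 0 / 2)
    + A₂ * ((∑ i, etaC (N i) (s i) * d i ^ (2 * s i))
        + d (Fin.last m) ^ 2 / 2
        - ∑ i, etaC (N i) (s i) * max (d i ^ 2 - ‖p.1 i‖ ^ 2) 0 ^ s i
        - max (d (Fin.last m) ^ 2 - p.2 ^ 2) 0 / 2)

/-- `sup` of `|u|` on the open annulus `B_{2ρ} ∖ closure(B_{ρ/2})`. -/
def annSup {n : ℕ} (u : EuclideanSpace ℝ (Fin n) → ℝ) (ρ : ℝ) : ℝ :=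
  sSup ((fun x => |u x|) '' {x | ρ / 2 < ‖x‖ ∧ ‖x‖ < 2 * ρ})

/-- `sup` of `|u|` on the open ball `B_r`. -/
def ballSup {n : ℕ} (u : EuclideanSpace ℝ (Fin n) → ℝ) (r : ℝ) : ℝ :=
  sSup ((fun x => |u x|) '' Metric.ball 0 r)


lemma aux_iter2_le (g : ℝ → ℝ) (c : ℝ) (hg : ContDiffAt ℝ 2 g 0)
    (h : ∀ᶠ t in nhds (0:ℝ), g t + g (-t) - 2 * g 0 ≤ c * t ^ 2) :
    iteratedDeriv 2 g 0 ≤ c := by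
  by_contra hlt
  push Not at hlt
  have hgn : ContDiffAt ℝ 2 (fun t => g (-t)) 0 := by
    have : ContDiffAt ℝ 2 g (-(0:ℝ)) := by simpa using hg
    exact ContDiffAt.comp (f := fun t : ℝ => -t) (0:ℝ) this contDiffAt_id.neg
  have hq : ContDiffAt ℝ 2 (fun t : ℝ => c * t ^ 2) 0 := by fun_prop
  have hq2 : iteratedDeriv 2 (fun t : ℝ => c * t ^ 2) 0 = 2 * c := by
    rw [iteratedDeriv_succ, iteratedDeriv_one]
    have : deriv (fun t : ℝ => c * t ^ 2) = fun t => 2 * c * t := by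
      funext t
      have := ((hasDerivAt_id t).pow 2).const_mul c
      have h2 := this.deriv
      simp only [id, Pi.pow_apply] at h2
      convert h2 using 1
      simp; ring
    rw [this]
    have := ((hasDerivAt_id (0:ℝ)).const_mul (2 * c)).deriv
    simpa using this
  set φ : ℝ → ℝ := fun t => g t + g (-t) - c * t ^ 2 with hφ
  have hφ2 : iteratedDeriv 2 φ 0 = 2 * iteratedDeriv 2 g 0 - 2 * c := by
    have e1 := iteratedDeriv_fun_sub (n := 2) (hg.add hgn) hq
    have e2 := iteratedDeriv_fun_add (n := 2) hg hgn
    have e3 := iteratedDeriv_comp_neg 2 g 0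
    simp only [Pi.add_apply, hφ] at *
    rw [hq2] at e1
    erw [e1, e2, e3]
    simp; ring
  have hmax : IsLocalMax φ 0 := by
    filter_upwards [h] with t ht
    simp only [hφ]
    norm_num
    linarith
  have hpos : deriv (deriv φ) 0 > 0 := by
    have : iteratedDeriv 2 φ 0 = deriv (deriv φ) 0 := by
      rw [iteratedDeriv_succ, iteratedDeriv_one]
    rw [← this, hφ2]; linarith
  have hcont : ContinuousAt φ 0 := ((hg.add hgn).sub hq).continuousAt
  have hmin := isLocalMin_of_deriv_deriv_pos hpos hmax.deriv_eq_zero hcont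
  have hc : φ =ᶠ[nhds 0] fun _ => φ 0 := by
    filter_upwards [hmin, hmax] with t h1 h2
    exact le_antisymm h2 h1
  have := hc.deriv.deriv_eq
  simp at this
  linarith

lemma aux_integrable (n : ℕ) (s : ℝ) (hs0 : 0 < s) (hs1 : s < 1) :
    Integrable (fun y : EuclideanSpace ℝ (Fin n) =>
      2 * min (‖y‖ ^ 2) (1 / 16) / ‖y‖ ^ ((n : ℝ) + 2 * s)) := by
  rcases Nat.eq_zero_or_pos n with rfl | hn
  · have : (fun y : EuclideanSpace ℝ (Fin 0) =>
      2 * min (‖y‖ ^ 2) (1 / 16) / ‖y‖ ^ (((0:ℕ) : ℝ) + 2 * s)) = fun _ => 0 := by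
      funext y
      have : y = 0 := Subsingleton.elim _ _
      subst this
      simp
    rw [this]; exact integrable_zero _ _ _
  · haveI : Nonempty (Fin n) := ⟨⟨0, hn⟩⟩
    haveI : Nontrivial (EuclideanSpace ℝ (Fin n)) := by
      apply Module.nontrivial_of_finrank_pos (R := ℝ)
      simpa using hn
    have key := integrable_fun_norm_addHaar (E := EuclideanSpace ℝ (Fin n)) volume
      (f := fun r : ℝ => 2 * min (r ^ 2) (1 / 16) / r ^ ((n : ℝ) + 2 * s))
    refine key.2 ?_
    have hdim : ∀ r : ℝ, 0 < r →
        r ^ (n - 1) / r ^ ((n : ℝ) + 2 * s) = r ^ (-1 - 2 * s) := by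
      intro r hr
      rw [← Real.rpow_natCast, ← Real.rpow_sub hr]
      congr 1
      push_cast [Nat.cast_sub hn]
      ring
    simp only [finrank_euclideanSpace, Fintype.card_fin, smul_eq_mul]
    rw [← Set.Ioc_union_Ioi_eq_Ioi (zero_le_one' ℝ)]
    refine IntegrableOn.union ?_ ?_
    · have h1 : IntegrableOn (fun r : ℝ => 2 * r ^ (1 - 2 * s)) (Set.Ioc 0 1) := by
        have := intervalIntegral.intervalIntegrable_rpow' (a := 0) (b := 1) (r := 1 - 2 * s)
          (by linarith)
        rw [intervalIntegrable_iff_integrableOn_Ioc_of_le zero_le_one] at this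
        exact this.const_mul 2
      refine Integrable.mono' h1 (by fun_prop) ?_
      refine (ae_restrict_iff' measurableSet_Ioc).2 (Eventually.of_forall fun r hr => ?_)
      have hr0 : 0 < r := hr.1
      have hm : 0 ≤ min (r ^ 2) (1 / 16 : ℝ) := by positivity
      rw [Real.norm_of_nonneg (by positivity)]
      calc r ^ (n - 1) * (2 * min (r ^ 2) (1 / 16) / r ^ ((n : ℝ) + 2 * s))
          = 2 * min (r ^ 2) (1 / 16) * (r ^ (n - 1) / r ^ ((n : ℝ) + 2 * s)) := by ring
        _ = 2 * min (r ^ 2) (1 / 16) * r ^ (-1 - 2 * s) := by rw [hdim r hr0]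
        _ ≤ 2 * r ^ 2 * r ^ (-1 - 2 * s) := by gcongr; exact min_le_left _ _
        _ = 2 * r ^ (1 - 2 * s) := by
          rw [mul_assoc, ← Real.rpow_natCast, ← Real.rpow_add hr0]
          congr 2; push_cast; ring
    · have h1 : IntegrableOn (fun r : ℝ => (1 / 8) * r ^ (-1 - 2 * s)) (Set.Ioi 1) :=
        (integrableOn_Ioi_rpow_of_lt (by linarith) one_pos).const_mul _
      refine Integrable.mono' h1 (by fun_prop) ?_
      refine (ae_restrict_iff' measurableSet_Ioi).2 (Eventually.of_forall fun r hr => ?_)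
      have hr0 : 0 < r := lt_trans one_pos hr
      have hm : 0 ≤ min (r ^ 2) (1 / 16 : ℝ) := by positivity
      rw [Real.norm_of_nonneg (by positivity)]
      calc r ^ (n - 1) * (2 * min (r ^ 2) (1 / 16) / r ^ ((n : ℝ) + 2 * s))
          = 2 * min (r ^ 2) (1 / 16) * (r ^ (n - 1) / r ^ ((n : ℝ) + 2 * s)) := by ring
        _ = 2 * min (r ^ 2) (1 / 16) * r ^ (-1 - 2 * s) := by rw [hdim r hr0]
        _ ≤ 2 * (1 / 16) * r ^ (-1 - 2 * s) := by gcongr; exact min_le_right _ _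
        _ = (1 / 8) * r ^ (-1 - 2 * s) := by ring

lemma aux_cns_nonneg (n : ℕ) (s : ℝ) (hs0 : 0 < s) : 0 ≤ cns n s := by
  unfold cns
  have : 0 < Real.Gamma (s + (n : ℝ) / 2) := Real.Gamma_pos_of_pos (by positivity)
  positivity

lemma aux_norm_incl {m : ℕ} (N : Fin (m + 1) → ℕ) (i : Fin (m + 1))
    (y : EuclideanSpace ℝ (Fin (N i))) : ‖grpIncl N i y‖ = ‖y‖ := by
  exact PiLp.norm_single 2 (fun i => EuclideanSpace ℝ (Fin (N i))) i y

lemma aux_incl_smul {m : ℕ} (N : Fin (m + 1) → ℕ) (i : Fin (m + 1)) (t : ℝ)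
    (y : EuclideanSpace ℝ (Fin (N i))) : grpIncl N i (t • y) = t • grpIncl N i y := by
  unfold grpIncl
  rw [Pi.single_smul, WithLp.toLp_smul]

lemma aux_line {E : Type*} [NormedAddCommGroup E] [NormedSpace ℝ E] (u : E → ℝ) (p v : E)
    (hp : ContDiffAt ℝ 2 u p) : ContDiffAt ℝ 2 (fun t : ℝ => u (p + t • v)) 0 := by
  have : ContDiffAt ℝ 2 u (p + (0:ℝ) • v) := by simpa using hp
  exact ContDiffAt.comp (f := fun t : ℝ => p + t • v) (0:ℝ) this (by fun_prop)

/-- the constant K -/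
def auxK (n : ℕ) (s : ℝ) : ℝ :=
  if s = 1 then 2 * n else
    cns n s * ∫ y : EuclideanSpace ℝ (Fin n), 2 * min (‖y‖ ^ 2) (1 / 16) / ‖y‖ ^ ((n : ℝ) + 2 * s)

lemma aux_K_nonneg (n : ℕ) (s : ℝ) (hs0 : 0 < s) : 0 ≤ auxK n s := by
  unfold auxK
  split_ifs
  · positivity
  · exact mul_nonneg (aux_cns_nonneg n s hs0) (integral_nonneg fun y => by positivity)

lemma aux_group {m : ℕ} (N : Fin (m + 1) → ℕ) (i : Fin (m + 1)) (s : ℝ)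
    (hs : s ∈ Set.Ioc (0:ℝ) 1) (u : GS N → ℝ) (p q : GS N)
    (hp : ContDiffAt ℝ 2 u p) (hq : ContDiffAt ℝ 2 u q)
    (hip : gInt N i s u p) (hiq : gInt N i s u q) (A : ℝ) (hA : 0 ≤ A)
    (h : ∀ y, (u (p + grpIncl N i y) - u (q + grpIncl N i y)) +
      (u (p - grpIncl N i y) - u (q - grpIncl N i y)) - 2 * (u p - u q)
        ≤ A * (2 * min (‖y‖ ^ 2) (1 / 16))) :
    -(A * auxK (N i) s) ≤ gLap N i s u p - gLap N i s u q := by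
  unfold gLap auxK
  by_cases h1 : s = 1
  · simp only [h1, if_true]
    have hj : ∀ j : Fin (N i), dirD2 u p (grpIncl N i (EuclideanSpace.single j 1)) -
        dirD2 u q (grpIncl N i (EuclideanSpace.single j 1)) ≤ 2 * A := by
      intro j
      unfold dirD2
      rw [← iteratedDeriv_fun_sub (aux_line u p _ hp) (aux_line u q _ hq)]
      refine aux_iter2_le _ _ ((aux_line u p _ hp).sub (aux_line u q _ hq)) ?_
      refine Eventually.of_forall fun t => ?_
      have := h (t • EuclideanSpace.single j 1)
      rw [aux_incl_smul] at this
      have hn : ‖t • (EuclideanSpace.single j 1 : EuclideanSpace ℝ (Fin (N i)))‖ ^ 2 = t ^ 2 := by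
        rw [norm_smul]; simp
      rw [hn] at this
      have hm : min (t ^ 2) (1 / 16 : ℝ) ≤ t ^ 2 := min_le_left _ _
      have := this.trans (mul_le_mul_of_nonneg_left
        (mul_le_mul_of_nonneg_left hm (by norm_num : (0:ℝ) ≤ 2)) hA)
      simp only [neg_smul, zero_smul, add_zero, ← sub_eq_add_neg]
      linarith
    have := Finset.sum_le_sum (s := Finset.univ) fun j _ => hj j
    rw [Finset.sum_sub_distrib] at this
    simp at this
    linarith
  · simp only [h1, if_false]
    have hs1 : s < 1 := lt_of_le_of_ne hs.2 h1
    have Ip := hip.resolve_left h1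
    have Iq := hiq.resolve_left h1
    have I0 := (aux_integrable (N i) s hs.1 hs1).const_mul (-A)
    rw [← mul_sub, ← integral_sub Ip Iq]
    have : ∫ y : EuclideanSpace ℝ (Fin (N i)),
        -A * (2 * min (‖y‖ ^ 2) (1 / 16) / ‖y‖ ^ ((N i : ℝ) + 2 * s)) ≤ _ :=
      integral_mono I0 (Ip.sub Iq) ?_
    · have h2 := mul_le_mul_of_nonneg_left this (aux_cns_nonneg (N i) s hs.1)
      rw [integral_const_mul] at h2
      refine le_trans (le_of_eq ?_) h2
      ring
    · intro y
      simp only [Pi.sub_apply]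
      rw [← sub_div, ← mul_div_assoc]
      gcongr
      have := h y
      linarith

lemma aux_last {m : ℕ} (N : Fin (m + 1) → ℕ) (hN : N (Fin.last m) = 1)
    (u : GS N → ℝ) (p : GS N) : gLap N (Fin.last m) 1 u p = - dirD2 u p (eN N) := by
  unfold gLap
  haveI : Subsingleton (Fin (N (Fin.last m))) := by rw [hN]; infer_instance
  have : ∀ j : Fin (N (Fin.last m)), grpIncl N (Fin.last m) (EuclideanSpace.single j 1) = eN N := by
    intro j
    unfold eN
    congr 1
    ext k
    simp [Subsingleton.elim k j]
  simp [this, hN]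

lemma aux_norm_eN {m : ℕ} (N : Fin (m + 1) → ℕ) (hN : N (Fin.last m) = 1) : ‖eN N‖ = 1 := by
  unfold eN
  rw [aux_norm_incl, EuclideanSpace.norm_eq]
  simp [hN]

lemma aux_min_sq {E : Type*} [NormedAddCommGroup E] [InnerProductSpace ℝ E] (z v : E)
    (hz : ‖z‖ < 1 / 4) :
    min (‖z + v‖ ^ 2) (1 / 16 : ℝ) + min (‖z - v‖ ^ 2) (1 / 16) - 2 * min (‖z‖ ^ 2) (1 / 16)
      ≤ 2 * min (‖v‖ ^ 2) (1 / 16) := by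
  have h0 : min (‖z‖ ^ 2) (1 / 16 : ℝ) = ‖z‖ ^ 2 := by
    apply min_eq_left
    nlinarith [norm_nonneg z]
  rw [h0]
  have hp := parallelogram_law_with_norm ℝ z v
  have h1 := min_le_left (‖z + v‖ ^ 2) (1 / 16 : ℝ)
  have h2 := min_le_left (‖z - v‖ ^ 2) (1 / 16 : ℝ)
  have h3 := min_le_right (‖z + v‖ ^ 2) (1 / 16 : ℝ)
  have h4 := min_le_right (‖z - v‖ ^ 2) (1 / 16 : ℝ)
  rcases min_cases (‖v‖ ^ 2) (1 / 16 : ℝ) with ⟨h, _⟩ | ⟨h, _⟩ <;> rw [h] <;>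
    nlinarith [sq_nonneg ‖z‖]

lemma aux_main {m : ℕ} (N : Fin (m + 1) → ℕ) (hN : N (Fin.last m) = 1)
    (s : Fin (m + 1) → ℝ) (hs : ∀ i, s i ∈ Set.Ioc (0 : ℝ) 1)
    (hsl : s (Fin.last m) = 1)
    (a : Fin (m + 1) → ℝ) (ha : ∀ i, 0 ≤ a i) (hal : 0 < a (Fin.last m))
    (u f : GS N → ℝ) (hsol : IsSol N a s u f (Metric.ball 0 1)) (Mf Mu : ℝ)
    (hf : ∀ x ∈ Metric.ball (0 : GS N) 1, |f x| ≤ Mf) (hu : ∀ x, |u x| ≤ Mu)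
    (x : GS N) (hx : x ∈ Metric.ball (0 : GS N) (1 / 2)) (A : ℝ)
    (hA1 : 11 * Mu ≤ A)
    (hA2 : 2 * Mf + 32 * Mu * ∑ i, a i * auxK (N i) (s i) < 2 * a (Fin.last m) * A)
    (t : ℝ) (ht : t ∈ Set.Icc (0:ℝ) (1 / 4)) :
    u (x + t • eN N) - u (x - t • eN N) ≤ A * t := by
  have hMu : 0 ≤ Mu := (abs_nonneg _).trans (hu 0)
  have hA0 : 0 ≤ A := by linarith
  obtain ⟨huc, hsol⟩ := hsol
  set e := eN N with he
  have hen : ‖e‖ = 1 := aux_norm_eN N hN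
  set w : GS N × ℝ → ℝ := fun P => u (x + P.1 + P.2 • e) - u (x + P.1 - P.2 • e)
    - A * (P.2 * (1 - P.2)) - 32 * Mu * min (‖P.1‖ ^ 2) (1 / 16) with hw
  have hwc : Continuous w := by
    simp only [hw]
    fun_prop
  by_contra hcon
  push Not at hcon
  have hdiff : ∀ p q, u p - u q ≤ 2 * Mu := by
    intro p q
    have h1 := abs_le.1 (hu p)
    have h2 := abs_le.1 (hu q)
    linarith
  have hpos1 : 0 < w (0, t) := by
    simp only [hw, add_zero, norm_zero]
    have : min ((0:ℝ) ^ 2) (1 / 16) = 0 := by norm_num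
    rw [this]
    nlinarith [mul_nonneg hA0 (sq_nonneg t)]
  have hout : ∀ (z : GS N) (τ : ℝ), τ ∈ Set.Icc (0:ℝ) (1 / 4) → 1 / 4 ≤ ‖z‖ → w (z, τ) ≤ 0 := by
    intro z τ hτ hz
    simp only [hw]
    have : min (‖z‖ ^ 2) (1 / 16 : ℝ) = 1 / 16 := by
      apply min_eq_right; nlinarith
    rw [this]
    have h1 := hdiff (x + z + τ • e) (x + z - τ • e)
    have h2 : 0 ≤ A * (τ * (1 - τ)) :=
      mul_nonneg hA0 (mul_nonneg hτ.1 (by linarith [hτ.2]))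
    linarith
  have hmn : ∀ z : GS N, 0 ≤ 32 * Mu * min (‖z‖ ^ 2) (1 / 16 : ℝ) := fun z => by positivity
  have h0 : ∀ z : GS N, w (z, 0) ≤ 0 := by
    intro z
    simp only [hw, zero_smul, add_zero, sub_zero]
    have := hmn z
    linarith
  have hT : ∀ z : GS N, w (z, 1 / 4) ≤ 0 := by
    intro z
    simp only [hw]
    have := hmn z
    have h1 := hdiff (x + z + (1 / 4 : ℝ) • e) (x + z - (1 / 4 : ℝ) • e)
    linarith
  obtain ⟨⟨z0, t0⟩, hmem, hmax⟩ := ((isCompact_closedBall (0 : GS N) (1 / 4)).prod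
    (isCompact_Icc (a := (0:ℝ)) (b := 1 / 4))).exists_isMaxOn ⟨(0, t), by simp [ht.1]; simpa using ht.2⟩
      hwc.continuousOn
  have hwpos : 0 < w (z0, t0) := lt_of_lt_of_le hpos1 (hmax ⟨by simp, ht⟩)
  have ht0 : t0 ∈ Set.Icc (0:ℝ) (1 / 4) := hmem.2
  have hz0 : ‖z0‖ < 1 / 4 := by
    by_contra hh
    push Not at hh
    linarith [hout z0 t0 ht0 hh]
  have ht0p : 0 < t0 := by
    rcases ht0.1.lt_or_eq with hh | hh
    · exact hh
    · rw [← hh] at hwpos; linarith [h0 z0]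
  have ht0l : t0 < 1 / 4 := by
    rcases ht0.2.lt_or_eq with hh | hh
    · exact hh
    · rw [hh] at hwpos; linarith [hT z0]
  have hglob : ∀ z, w (z, t0) ≤ w (z0, t0) := by
    intro z
    by_cases hz : ‖z‖ ≤ 1 / 4
    · exact hmax ⟨by simpa using hz, ht0⟩
    · exact (hout z t0 ht0 (le_of_not_ge hz)).trans hwpos.le
  set p := x + z0 + t0 • e with hp
  set q := x + z0 - t0 • e with hq
  have hxn : ‖x‖ < 1 / 2 := by simpa using hx
  have hte : ‖t0 • e‖ < 1 / 4 := by
    rw [norm_smul, hen, Real.norm_of_nonneg ht0p.le]; linarith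
  have hpB : p ∈ Metric.ball (0 : GS N) 1 := by
    rw [mem_ball_zero_iff]
    have h1 := norm_add_le (x + z0) (t0 • e)
    have h2 := norm_add_le x z0
    linarith
  have hqB : q ∈ Metric.ball (0 : GS N) 1 := by
    rw [mem_ball_zero_iff]
    have h1 := norm_sub_le (x + z0) (t0 • e)
    have h2 := norm_add_le x z0
    linarith
  obtain ⟨hpd, hpi, hpL⟩ := hsol p hpB
  obtain ⟨hqd, hqi, hqL⟩ := hsol q hqB
  have hgrp : ∀ i, -(32 * Mu * auxK (N i) (s i)) ≤ gLap N i (s i) u p - gLap N i (s i) u q := by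
    intro i
    refine aux_group N i (s i) (hs i) u p q hpd hqd (hpi i) (hqi i) (32 * Mu) (by positivity) ?_
    intro y
    set v := grpIncl N i y
    have hv : ‖v‖ = ‖y‖ := aux_norm_incl N i y
    have h1 := hglob (z0 + v)
    have h2 := hglob (z0 - v)
    simp only [hw] at h1 h2
    have e1 : x + (z0 + v) + t0 • e = p + v := by rw [hp]; abel
    have e2 : x + (z0 + v) - t0 • e = q + v := by rw [hq]; abel
    have e3 : x + (z0 - v) + t0 • e = p - v := by rw [hp]; abel
    have e4 : x + (z0 - v) - t0 • e = q - v := by rw [hq]; abel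
    rw [e1, e2, ← hp, ← hq] at h1
    rw [e3, e4, ← hp, ← hq] at h2
    have h3 := mul_le_mul_of_nonneg_left (aux_min_sq z0 v hz0) (by positivity : 0 ≤ 32 * Mu)
    rw [hv] at h3
    linarith
  have hlast : 2 * A ≤ gLap N (Fin.last m) (s (Fin.last m)) u p
      - gLap N (Fin.last m) (s (Fin.last m)) u q := by
    rw [hsl, aux_last N hN, aux_last N hN, ← he]
    unfold dirD2
    have hq' := aux_line u q e hqd
    have hqn := aux_line u q (-e) hqd
    have e3 : iteratedDeriv 2 (fun t : ℝ => u (q + t • (-e))) 0 =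
        iteratedDeriv 2 (fun t : ℝ => u (q + t • e)) 0 := by
      have := iteratedDeriv_comp_neg 2 (fun t : ℝ => u (q + t • e)) 0
      simpa using this
    have key : iteratedDeriv 2 (fun t : ℝ => u (p + t • e) - u (q + t • (-e))) 0 ≤ -2 * A := by
      refine aux_iter2_le _ _ ((aux_line u p e hpd).sub hqn) ?_
      have hnb : Set.Ioo (-(min t0 (1 / 4 - t0))) (min t0 (1 / 4 - t0)) ∈ nhds (0:ℝ) := by
        have : 0 < min t0 (1 / 4 - t0) := lt_min ht0p (by linarith)
        exact Ioo_mem_nhds (by linarith) this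
      filter_upwards [hnb] with τ hτ
      have m1 := min_le_left t0 (1 / 4 - t0)
      have m2 := min_le_right t0 (1 / 4 - t0)
      have h1 : w (z0, t0 + τ) ≤ w (z0, t0) :=
        hmax ⟨hmem.1, ⟨by linarith [hτ.1], by linarith [hτ.2]⟩⟩
      have h2 : w (z0, t0 - τ) ≤ w (z0, t0) :=
        hmax ⟨hmem.1, ⟨by linarith [hτ.2], by linarith [hτ.1]⟩⟩
      simp only [hw] at h1 h2
      have e1 : x + z0 + (t0 + τ) • e = p + τ • e := by rw [hp]; module
      have e2 : x + z0 - (t0 + τ) • e = q + τ • (-e) := by rw [hq]; module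
      have e3 : x + z0 + (t0 - τ) • e = p + (-τ) • e := by rw [hp]; module
      have e4 : x + z0 - (t0 - τ) • e = q + (-τ) • (-e) := by rw [hq]; module
      rw [e1, e2, ← hp, ← hq] at h1
      rw [e3, e4, ← hp, ← hq] at h2
      simp only [zero_smul, add_zero]
      nlinarith
    rw [iteratedDeriv_fun_sub (aux_line u p e hpd) hqn, e3] at key
    linarith
  have hsum : f p - f q = ∑ i, a i * (gLap N i (s i) u p - gLap N i (s i) u q) := by
    rw [← hpL, ← hqL]
    unfold Lop
    rw [← Finset.sum_sub_distrib]
    exact Finset.sum_congr rfl fun i _ => by ring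
  have hlow : 2 * a (Fin.last m) * A - 32 * Mu * ∑ i, a i * auxK (N i) (s i) ≤ f p - f q := by
    rw [hsum, ← Finset.add_sum_erase Finset.univ
        (fun i => a i * (gLap N i (s i) u p - gLap N i (s i) u q)) (Finset.mem_univ (Fin.last m)),
      ← Finset.add_sum_erase Finset.univ (fun i => a i * auxK (N i) (s i))
        (Finset.mem_univ (Fin.last m))]
    have h1 := mul_le_mul_of_nonneg_left hlast hal.le
    have h2 : ∑ i ∈ Finset.univ.erase (Fin.last m), -(32 * Mu * (a i * auxK (N i) (s i))) ≤
        ∑ i ∈ Finset.univ.erase (Fin.last m),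
          a i * (gLap N i (s i) u p - gLap N i (s i) u q) := by
      refine Finset.sum_le_sum fun i _ => ?_
      have := mul_le_mul_of_nonneg_left (hgrp i) (ha i)
      linarith
    rw [Finset.sum_neg_distrib, ← Finset.mul_sum] at h2
    have h3 : 0 ≤ 32 * Mu * (a (Fin.last m) * auxK (N (Fin.last m)) (s (Fin.last m))) :=
      mul_nonneg (by positivity) (mul_nonneg hal.le (aux_K_nonneg _ _ (hs _).1))
    linarith
  have f1 := abs_le.1 (hf p hpB)
  have f2 := abs_le.1 (hf q hqB)
  linarith

lemma aux_neg {m : ℕ} (N : Fin (m + 1) → ℕ) (a s : Fin (m + 1) → ℝ)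
    (u f : GS N → ℝ) (Ω : Set (GS N)) (h : IsSol N a s u f Ω) :
    IsSol N a s (fun x => -u x) (fun x => -f x) Ω := by
  refine ⟨h.1.neg, fun x hx => ?_⟩
  obtain ⟨h1, h2, h3⟩ := h.2 x hx
  refine ⟨h1.neg, fun i => ?_, ?_⟩
  · rcases h2 i with h4 | h4
    · exact Or.inl h4
    · right
      convert h4.neg using 1
      funext y
      simp only [Pi.neg_apply]
      ring
  · show _ = -f x
    rw [← h3]
    unfold Lop
    rw [← Finset.sum_neg_distrib]
    refine Finset.sum_congr rfl fun i _ => ?_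
    rw [← mul_neg]
    congr 1
    unfold gLap
    split_ifs
    · unfold dirD2
      simp
    · rw [← mul_neg, ← integral_neg]
      congr 2
      funext y
      ring

lemma aux_deriv {E : Type*} [NormedAddCommGroup E] [NormedSpace ℝ E] (u : E → ℝ) (x e : E)
    (hd : DifferentiableAt ℝ (fun τ : ℝ => u (x + τ • e)) 0) (A : ℝ)
    (h : ∀ t ∈ Set.Icc (0:ℝ) (1 / 4), u (x + t • e) - u (x - t • e) ≤ A * t) :
    2 * deriv (fun τ : ℝ => u (x + τ • e)) 0 ≤ A := by
  set g := fun τ : ℝ => u (x + τ • e) with hg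
  have h1 := hd.hasDerivAt
  have h2 : HasDerivAt (fun t => g (-t)) (-(deriv g 0)) 0 := by
    have h1' : HasDerivAt g (deriv g 0) (-(0:ℝ)) := by simpa using h1
    have := h1'.scomp (h := fun t : ℝ => -t) (0:ℝ) (hasDerivAt_neg (0:ℝ))
    simpa using! this
  have h3 := (h1.sub h2).tendsto_slope_zero_right
  have : deriv g 0 - -deriv g 0 = 2 * deriv g 0 := by ring
  rw [this] at h3
  refine le_of_tendsto h3 ?_
  have : Set.Ioc (0:ℝ) (1 / 4) ∈ nhdsWithin (0:ℝ) (Set.Ioi 0) :=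
    Ioc_mem_nhdsGT (by norm_num)
  filter_upwards [this] with t ht
  have := h t ⟨ht.1.le, ht.2⟩
  simp only [hg, Pi.sub_apply, zero_add, neg_smul, zero_smul, neg_zero, smul_eq_mul, sub_self,
    sub_zero, ← sub_eq_add_neg, add_zero]
  rw [inv_mul_le_iff₀ ht.1]
  linarith

/-- Corollary 1.2: interior Lipschitz estimate in the last variable. -/
theorem stmt1 {m : ℕ} (N : Fin (m + 1) → ℕ) (hN : N (Fin.last m) = 1)
    (s : Fin (m + 1) → ℝ) (hs : ∀ i, s i ∈ Set.Ioc (0 : ℝ) 1)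
    (hsl : s (Fin.last m) = 1)
    (a : Fin (m + 1) → ℝ) (ha : ∀ i, 0 ≤ a i) (hal : 0 < a (Fin.last m)) :
    ∃ C > 0, ∀ (u f : GS N → ℝ),
      IsSol N a s u f (Metric.ball 0 1) →
      ∀ Mf Mu : ℝ,
        (∀ x ∈ Metric.ball (0 : GS N) 1, |f x| ≤ Mf) →
        (∀ x, |u x| ≤ Mu) →
        ∀ x ∈ Metric.ball (0 : GS N) (1 / 2),
          |deriv (fun τ : ℝ => u (x + τ • eN N)) 0| ≤ C * (Mf + Mu) := by
  set K := ∑ i, a i * auxK (N i) (s i) with hK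
  have hK0 : 0 ≤ K := Finset.sum_nonneg fun i _ => mul_nonneg (ha i) (aux_K_nonneg _ _ (hs i).1)
  set b := a (Fin.last m) with hb
  refine ⟨1 / b + 16 * K / b + 11, by positivity, ?_⟩
  intro u f hsol Mf Mu hf hu x hx
  have hMu : 0 ≤ Mu := (abs_nonneg _).trans (hu 0)
  have hMf : 0 ≤ Mf := (abs_nonneg _).trans (hf 0 (by simp))
  have hxB : x ∈ Metric.ball (0 : GS N) 1 := Metric.ball_subset_ball (by norm_num) hx
  have hd : DifferentiableAt ℝ (fun τ : ℝ => u (x + τ • eN N)) 0 :=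
    (aux_line u x (eN N) (hsol.2 x hxB).1).differentiableAt (by norm_num)
  refine le_of_forall_pos_le_add fun ε hε => ?_
  set A := (1 / b + 16 * K / b + 11) * (Mf + Mu) + ε with hA
  have hKb : 0 ≤ 16 * K / b := by positivity
  have hb1 : 0 ≤ 1 / b := by positivity
  have hA1 : 11 * Mu ≤ A := by
    have h1 : 0 ≤ (1 / b + 16 * K / b) * (Mf + Mu) := by positivity
    rw [hA]; linarith
  have hA2 : 2 * Mf + 32 * Mu * K < 2 * b * A := by
    have e : 2 * b * A = 2 * (Mf + Mu) + 32 * K * (Mf + Mu) + 22 * b * (Mf + Mu) + 2 * b * ε := by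
      rw [hA]; field_simp; ring
    have h1 : 0 < b * ε := by positivity
    have h2 : 0 ≤ b * (Mf + Mu) := by positivity
    have h3 : 0 ≤ K * Mf := by positivity
    rw [e]; linarith
  have hA0 : 0 ≤ A := by linarith
  have k1 := aux_deriv u x (eN N) hd A
    (aux_main N hN s hs hsl a ha hal u f hsol Mf Mu hf hu x hx A hA1 hA2)
  have k2 := aux_deriv (fun x => -u x) x (eN N) hd.neg A
    (aux_main N hN s hs hsl a ha hal _ _ (aux_neg N a s u f _ hsol) Mf Mu
      (fun x hx => by simpa using hf x hx) (fun x => by simpa using hu x) x hx A hA1 hA2)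
  have k3 : deriv (fun τ : ℝ => -u (x + τ • eN N)) 0 =
      -deriv (fun τ : ℝ => u (x + τ • eN N)) 0 := deriv.fun_neg
  rw [k3] at k2
  rw [abs_le]
  constructor <;> linarith

end
end

section
/- Let s ∈ (0,1), let all coefficients a_1, …, a_{m-1}, a be strictly positive, and set L_* u := Σ_{i=1}^{m-1} a_i (-Δ_{X_i})^{s} u - a ∂²_{x_n} u. Let f : ℝ^n → ℝ be bounded on ℝ^n and Lipschitz continuous in the variable x_n on B_1, i.e. |f(x + t e_n) - f(x)| ≤ K·|t| whenever x and x + t e_n lie in B_1, with best constant K =: ‖∂_{x_n} f‖_{L^∞(B_1)}. Let u : ℝ^n → ℝ be a bounded classical solution of L_* u = f in B_1^{n-1} × ℝ. Set γ := 2s if s < 1/2, and γ := 1 - ε for an arbitrary ε ∈ (0,1) if s ≥ 1/2. Then there exists C > 0, depending only on a_1, …, a_{m-1}, a, s, N_1, …, N_{m-1} (and on ε when s ≥ 1/2), such that |u(x) - u(y)| ≤ C·( ‖f‖_{L^∞(ℝ^n)} + ‖∂_{x_n} f‖_{L^∞(B_1)} + ‖u‖_{L^∞(ℝ^n)} )·|x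 - y|^γ for all x, y ∈ B_{1/2}. -/
open MeasureTheory Real Filter

noncomputable section

lemma cns_pos (N : ℕ) {s : ℝ} (h0 : 0 < s) (h1 : s < 1) : 0 < cns N s := by
  have hG : Real.Gamma (-s) ≠ 0 := by
    apply Real.Gamma_ne_zero
    intro k hk
    have hk' : s = k := by linarith
    rcases Nat.eq_zero_or_pos k with rfl | hp
    · simp at hk'; linarith
    · have : (1 : ℝ) ≤ k := by exact_mod_cast hp
      linarith
  have h2 : 0 < Real.Gamma (s + (N : ℝ) / 2) := Real.Gamma_pos_of_pos (by positivity)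
  have h3 : 0 < |Real.Gamma (-s)| := abs_pos.mpr hG
  have := Real.pi_pos
  unfold cns
  positivity

lemma rpow_aux1 {γ θ : ℝ} (h0 : 0 < γ) (h1 : γ < 1) (ht0 : 0 ≤ θ) (ht1 : θ < 1) :
    (1 - θ) ^ γ ≤ 1 - γ * θ - γ * (1 - γ) / 2 * θ ^ 2 := by
  have hder : ∀ x ∈ Set.Ico (0 : ℝ) 1,
      HasDerivAt (fun x : ℝ => 1 - γ * x - γ * (1 - γ) / 2 * x ^ 2 - (1 - x) ^ γ)
        (0 - γ * 1 - γ * (1 - γ) / 2 * ((2 : ℕ) * x ^ 1 * 1) - (-1) * γ * (1 - x) ^ (γ - 1)) x := by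
    intro x hx
    have hx' : 1 - x ≠ 0 := by have := hx.2; linarith
    have e1 : HasDerivAt (fun x : ℝ => 1 - x) (-1) x := by
      simpa using (hasDerivAt_id x).const_sub 1
    have e2 := e1.rpow_const (p := γ) (Or.inl hx')
    exact ((((hasDerivAt_const x (1 : ℝ)).sub ((hasDerivAt_id x).const_mul γ)).sub
      (((hasDerivAt_id x).pow 2).const_mul (γ * (1 - γ) / 2))).sub e2)
  have hmono : MonotoneOn (fun x : ℝ => 1 - γ * x - γ * (1 - γ) / 2 * x ^ 2 - (1 - x) ^ γ)
      (Set.Ico (0 : ℝ) 1) := by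
    apply monotoneOn_of_deriv_nonneg (convex_Ico 0 1)
    · intro x hx
      exact (hder x hx).continuousAt.continuousWithinAt
    · intro x hx
      rw [interior_Ico] at hx
      exact (hder x ⟨hx.1.le, hx.2⟩).differentiableAt.differentiableWithinAt
    · intro x hx
      rw [interior_Ico] at hx
      rw [(hder x ⟨hx.1.le, hx.2⟩).deriv]
      obtain ⟨hx0, hx1⟩ := hx
      have hb : (1 - x) ^ (1 - γ) ≤ 1 - (1 - γ) * x := by
        have := rpow_one_add_le_one_add_mul_self (s := -x) (by linarith) (p := 1 - γ)
          (by linarith) (by linarith)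
        rw [← sub_eq_add_neg] at this
        linarith
      have hp : 0 < (1 - x) ^ (1 - γ) := Real.rpow_pos_of_pos (by linarith) _
      have hi : (1 - x) ^ (γ - 1) = ((1 - x) ^ (1 - γ))⁻¹ := by
        rw [← Real.rpow_neg (by linarith)]; congr 1; ring
      have hk : 1 + (1 - γ) * x ≤ (1 - x) ^ (γ - 1) := by
        rw [hi, ← one_div, le_div_iff₀ hp]
        have hq : 0 ≤ (1 - γ) * x := by apply mul_nonneg <;> linarith
        nlinarith
      have := mul_le_mul_of_nonneg_left hk h0.le
      simp
      nlinarith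
  have := hmono (a := 0) ⟨le_rfl, one_pos⟩ (b := θ) ⟨ht0, ht1⟩ ht0
  simp at this
  linarith

lemma rpow_aux2 {γ θ : ℝ} (h0 : 0 < γ) (h1 : γ < 1) (ht1 : |θ| < 1) :
    (1 + θ) ^ γ + (1 - θ) ^ γ ≤ 2 - γ * (1 - γ) / 2 * θ ^ 2 := by
  have key : ∀ θ : ℝ, 0 ≤ θ → θ < 1 →
      (1 + θ) ^ γ + (1 - θ) ^ γ ≤ 2 - γ * (1 - γ) / 2 * θ ^ 2 := by
    intro θ a b
    have := rpow_aux1 h0 h1 a b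
    have := rpow_one_add_le_one_add_mul_self (s := θ) (by linarith) (p := γ) h0.le h1.le
    linarith
  rcases le_total 0 θ with h | h
  · exact key θ h (lt_of_abs_lt ht1)
  · have := key (-θ) (by linarith) (by have := neg_lt_of_abs_lt ht1; linarith)
    rw [sub_neg_eq_add, ← sub_eq_add_neg] at this
    nlinarith

lemma norm_aux {E : Type*} [NormedAddCommGroup E] [NormedSpace ℝ E] {γ σ : ℝ} (h0 : 0 < γ)
    (h1 : γ < 1) (d : E) (hσ : |σ| < 1) :
    γ * (1 - γ) / 2 * ‖d‖ ^ γ * σ ^ 2 ≤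
      2 * ‖d‖ ^ γ - ‖d + σ • d‖ ^ γ - ‖d - σ • d‖ ^ γ := by
  obtain ⟨ha, hb⟩ := abs_lt.mp hσ
  have e1 : ‖d + σ • d‖ = (1 + σ) * ‖d‖ := by
    have : d + σ • d = (1 + σ) • d := by rw [add_smul, one_smul]
    rw [this, norm_smul, Real.norm_of_nonneg (by linarith)]
  have e2 : ‖d - σ • d‖ = (1 - σ) * ‖d‖ := by
    have : d - σ • d = (1 - σ) • d := by rw [sub_smul, one_smul]
    rw [this, norm_smul, Real.norm_of_nonneg (by linarith)]
  rw [e1, e2, Real.mul_rpow (by linarith) (norm_nonneg _),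
    Real.mul_rpow (by linarith) (norm_nonneg _)]
  have := mul_le_mul_of_nonneg_right (rpow_aux2 h0 h1 hσ) (Real.rpow_nonneg (norm_nonneg d) γ)
  nlinarith

lemma second_aux (v₁ v₂ : ℝ → ℝ) (k : ℝ) (h₁ : ContDiffAt ℝ 2 v₁ 0) (h₂ : ContDiffAt ℝ 2 v₂ 0)
    (h : ∀ᶠ t in nhds (0 : ℝ),
      (v₁ t + v₁ (-t) - 2 * v₁ 0) - (v₂ t + v₂ (-t) - 2 * v₂ 0) ≤ k * t ^ 2) :
    iteratedDeriv 2 v₁ 0 - iteratedDeriv 2 v₂ 0 ≤ k := by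
  rw [← iteratedDeriv_sub (n := 2) h₁ h₂]
  set w := v₁ - v₂ with hw
  have hwc : ContDiffAt ℝ 2 w 0 := h₁.sub h₂
  have hw2 : iteratedDeriv 2 w 0 = deriv (deriv w) 0 := by
    rw [iteratedDeriv_succ, iteratedDeriv_one]
  rw [hw2]
  by_contra! hlt
  set W := deriv (deriv w) 0 with hW
  set k' := (W + k) / 2 with hk'
  have hd1 : ∀ᶠ t in nhds (0 : ℝ), HasDerivAt w (deriv w t) t := by
    filter_upwards [hwc.eventually (by simp)] with t ht
    exact (ht.differentiableAt (by simp)).hasDerivAt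
  have hd2 : HasDerivAt (deriv w) W 0 := by
    have : ContDiffAt ℝ 1 (deriv w) 0 := by
      have h3 : ContDiffAt ℝ 1 (fderiv ℝ w) 0 := hwc.fderiv_right (by norm_num)
      have h4 : deriv w = fun t => fderiv ℝ w t 1 := by
        funext t; exact fderiv_apply_one_eq_deriv.symm
      rw [h4]
      exact h3.clm_apply contDiffAt_const
    exact (this.differentiableAt (by simp)).hasDerivAt
  have hneg : Tendsto (fun t : ℝ => -t) (nhds 0) (nhds 0) := by
    simpa using (continuous_neg.tendsto (0 : ℝ))
  set H : ℝ → ℝ := fun t => w t + w (-t) - 2 * w 0 - k' * t ^ 2 with hH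
  have hH1 : ∀ᶠ t in nhds (0 : ℝ),
      HasDerivAt H (deriv w t - deriv w (-t) - k' * (2 * t)) t := by
    filter_upwards [hd1, hneg.eventually hd1] with t ht ht'
    have e1 : HasDerivAt (fun t => w (-t)) (deriv w (-t) * (-1)) t :=
      HasDerivAt.comp t ht' (hasDerivAt_neg t)
    have e2 : HasDerivAt (fun t : ℝ => k' * t ^ 2) (k' * (2 * t)) t := by
      simpa using (hasDerivAt_pow 2 t).const_mul k'
    exact (((ht.add e1).sub_const (2 * w 0)).sub e2).congr_deriv (by ring)
  have hHd : deriv H =ᶠ[nhds 0] fun t => deriv w t - deriv w (-t) - k' * (2 * t) := by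
    filter_upwards [hH1] with t ht using ht.deriv
  have hH2 : HasDerivAt (fun t => deriv w t - deriv w (-t) - k' * (2 * t)) (2 * W - 2 * k') 0 := by
    have hd2' : HasDerivAt (deriv w) W (-0) := by simpa using hd2
    have e1 : HasDerivAt (fun t => deriv w (-t)) (W * (-1)) 0 :=
      HasDerivAt.comp (0 : ℝ) hd2' (hasDerivAt_neg 0)
    have e2 : HasDerivAt (fun t : ℝ => k' * (2 * t)) (k' * (2 * 1)) 0 :=
      ((hasDerivAt_id (0 : ℝ)).const_mul 2).const_mul k'
    exact ((hd2.sub e1).sub e2).congr_deriv (by ring)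
  have hmin : IsLocalMin H 0 := by
    apply isLocalMin_of_deriv_deriv_pos
    · rw [hHd.deriv_eq, hH2.deriv]
      rw [hk']; linarith
    · rw [hHd.eq_of_nhds]; simp
    · exact hH1.self_of_nhds.continuousAt
  have hev : ∀ᶠ t in nhds (0 : ℝ), t = 0 := by
    filter_upwards [hmin, h] with t ht1 ht2
    by_contra hne
    have hpos : 0 < t ^ 2 := by positivity
    simp only [hH, hw, Pi.sub_apply] at ht1
    simp at ht1
    have : k' * t ^ 2 ≤ k * t ^ 2 := by linarith
    have := le_of_mul_le_mul_right this hpos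
    rw [hk'] at this
    linarith
  obtain ⟨ε, hε, hb⟩ := Metric.eventually_nhds_iff.mp hev
  have := @hb (ε / 2) (by simp [abs_of_pos hε]; linarith)
  linarith

lemma integrable_ker (n : ℕ) {s : ℝ} (h0 : 0 < s) (h1 : s < 1) :
    Integrable (fun y : EuclideanSpace ℝ (Fin n) =>
      min (‖y‖ ^ 2) 1 / ‖y‖ ^ ((n : ℝ) + 2 * s)) := by
  rcases Nat.eq_zero_or_pos n with rfl | hn
  · exact Integrable.of_finite
  have : Nonempty (Fin n) := ⟨⟨0, hn⟩⟩
  have : Nontrivial (EuclideanSpace ℝ (Fin n)) := inferInstance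
  rw [integrable_fun_norm_addHaar (volume : Measure (EuclideanSpace ℝ (Fin n)))
    (f := fun t : ℝ => min (t ^ 2) 1 / t ^ ((n : ℝ) + 2 * s))]
  have hpt : ∀ t : ℝ, 0 < t → t ^ (n - 1) • (min (t ^ 2) 1 / t ^ ((n : ℝ) + 2 * s)) =
      min (t ^ 2) 1 * t ^ (-1 - 2 * s) := by
    intro t ht
    have : t ^ (-1 - 2 * s) = t ^ (n - 1) / t ^ ((n : ℝ) + 2 * s) := by
      rw [← Real.rpow_natCast, ← Real.rpow_sub ht]
      congr 1
      rw [Nat.cast_sub hn]; push_cast; ring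
    rw [this, smul_eq_mul]; ring
  simp only [finrank_euclideanSpace, Fintype.card_fin]
  rw [← Set.Ioc_union_Ioi_eq_Ioi (zero_le_one (α := ℝ))]
  apply IntegrableOn.union
  · have := (intervalIntegral.intervalIntegrable_rpow' (a := 0) (b := 1) (r := 1 - 2 * s)
      (by linarith)).1
    refine this.congr_fun (fun t ht => ?_) measurableSet_Ioc
    have ht0 := ht.1
    have ht1 : t ^ 2 ≤ 1 := pow_le_one₀ ht.1.le ht.2
    beta_reduce
    rw [hpt t ht0, min_eq_left ht1, ← Real.rpow_natCast, ← Real.rpow_add ht0]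
    congr 1; push_cast; ring
  · have := integrableOn_Ioi_rpow_of_lt (a := -1 - 2 * s) (by linarith) one_pos
    refine this.congr_fun (fun t ht => ?_) measurableSet_Ioi
    have ht0 : (1 : ℝ) < t := ht
    have ht1 : 1 ≤ t ^ 2 := one_le_pow₀ ht0.le
    beta_reduce
    rw [hpt t (by linarith), min_eq_right ht1, one_mul]
lemma nonloc_sync {n : ℕ} {s B : ℝ} (h0 : 0 < s) (h1 : s < 1)
    (gp gq : EuclideanSpace ℝ (Fin n) → ℝ)
    (hp : Integrable (fun y => gp y / ‖y‖ ^ ((n : ℝ) + 2 * s)))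
    (hq : Integrable (fun y => gq y / ‖y‖ ^ ((n : ℝ) + 2 * s)))
    (h : ∀ y, -(B * min (‖y‖ ^ 2) 1) ≤ gp y - gq y) :
    -(B * ∫ y : EuclideanSpace ℝ (Fin n), min (‖y‖ ^ 2) 1 / ‖y‖ ^ ((n : ℝ) + 2 * s)) ≤
      (∫ y, gp y / ‖y‖ ^ ((n : ℝ) + 2 * s)) - ∫ y, gq y / ‖y‖ ^ ((n : ℝ) + 2 * s) := by
  rw [← integral_sub hp hq, ← integral_const_mul, ← integral_neg]
  apply integral_mono ((integrable_ker n h0 h1).const_mul B).neg (hp.sub hq)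
  intro y
  have hk : 0 ≤ ‖y‖ ^ ((n : ℝ) + 2 * s) := by positivity
  have := div_le_div_of_nonneg_right (h y) hk
  simp only [Pi.neg_apply, Pi.sub_apply]
  rw [← sub_div]
  refine le_trans (le_of_eq ?_) this
  ring

lemma nonloc_refl {n : ℕ} {s A B γ : ℝ} (h0 : 0 < s) (h1 : s < 1) (hA : 0 ≤ A)
    (hγ0 : 0 < γ) (hγ1 : γ < 1) (hγs : γ ≤ 2 * s)
    (gp gq : EuclideanSpace ℝ (Fin n) → ℝ)
    (hp : Integrable (fun y => gp y / ‖y‖ ^ ((n : ℝ) + 2 * s)))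
    (hq : Integrable (fun y => gq y / ‖y‖ ^ ((n : ℝ) + 2 * s)))
    (d : EuclideanSpace ℝ (Fin n)) (hd : d ≠ 0) (hd1 : ‖d‖ ≤ 1)
    (h : ∀ y, -(B * min (‖y‖ ^ 2) 1) ≤ gp y - gq y)
    (h' : ∀ y, ‖y‖ < ‖d‖ / 2 →
      A * (γ * (1 - γ) / 2 * ‖d‖ ^ γ * (2 * (inner ℝ d y / ‖d‖ ^ 2)) ^ 2)
        -(B * min (‖y‖ ^ 2) 1) ≤ gp y - gq ((ℝ ∙ d).reflection y)) :
    A * (γ * (1 - γ) / 2 / 16 * (1 / 8) ^ n *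
        volume.real (Metric.ball (0 : EuclideanSpace ℝ (Fin n)) 1))
      -(B * ∫ y : EuclideanSpace ℝ (Fin n), min (‖y‖ ^ 2) 1 / ‖y‖ ^ ((n : ℝ) + 2 * s)) ≤
      (∫ y, gp y / ‖y‖ ^ ((n : ℝ) + 2 * s)) - ∫ y, gq y / ‖y‖ ^ ((n : ℝ) + 2 * s) := by
  set ρ : ℝ := (n : ℝ) + 2 * s with hρ
  have hρ0 : 0 < ρ := by positivity
  have hr : 0 < ‖d‖ := norm_pos_iff.mpr hd
  set S : Set (EuclideanSpace ℝ (Fin n)) := Metric.ball 0 (‖d‖ / 2) with hS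
  have hSm : MeasurableSet S := Metric.isOpen_ball.measurableSet
  set Rf := (Submodule.span ℝ {d}).reflection with hRf
  have hmp : MeasurePreserving Rf (volume : Measure (EuclideanSpace ℝ (Fin n))) volume := Rf.measurePreserving
  have hemb : MeasurableEmbedding Rf := Rf.toHomeomorph.measurableEmbedding
  set F : EuclideanSpace ℝ (Fin n) → ℝ := fun y => gq y / ‖y‖ ^ ρ with hF
  set G : EuclideanSpace ℝ (Fin n) → ℝ := fun y => (S.indicator F) (Rf y) + (Sᶜ).indicator F y with hG
  have i1 : Integrable (S.indicator F) := hq.indicator hSm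
  have i2 : Integrable (Sᶜ.indicator F) := hq.indicator hSm.compl
  have i3 : Integrable (fun y => (S.indicator F) (Rf y)) :=
    (hmp.integrable_comp_emb hemb).mpr i1
  have hGi : Integrable G := i3.add i2
  have hGF : ∫ y, G y = ∫ y, F y := by
    rw [hG, integral_add i3 i2, hmp.integral_comp hemb (S.indicator F), ← integral_add i1 i2]
    congr 1
    funext y
    exact Set.indicator_self_add_compl_apply S F y
  have hRS : ∀ y, Rf y ∈ S ↔ y ∈ S := by
    intro y; simp [hS]
  set κ := γ * (1 - γ) / 2 / 16 with hκ
  have hκ0 : 0 < κ := by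
    have : 0 < 1 - γ := by linarith
    positivity
  set V : Set (EuclideanSpace ℝ (Fin n)) := Metric.ball ((1 / 4 : ℝ) • d) (‖d‖ / 8) with hV
  have hVm : MeasurableSet V := Metric.isOpen_ball.measurableSet
  have hVr : volume.real V = ‖d‖ ^ n * (1 / 8) ^ n * volume.real (Metric.ball (0 : EuclideanSpace ℝ (Fin n)) 1) := by
    rw [hV, Measure.addHaar_real_ball_center, Measure.real,
      Measure.addHaar_ball_of_pos _ _ (by positivity), ENNReal.toReal_mul,
      ENNReal.toReal_ofReal (by positivity)]
    simp only [finrank_euclideanSpace, Fintype.card_fin]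
    rw [div_eq_mul_one_div, mul_pow]; rfl
  have hVfin : volume V ≠ ⊤ := measure_ball_lt_top.ne
  have iV : Integrable (V.indicator (fun _ : EuclideanSpace ℝ (Fin n) => A * κ * ‖d‖ ^ γ / ‖d‖ ^ ρ)) :=
    (integrable_indicator_iff hVm).mpr (integrableOn_const hVfin)
  have hker := (integrable_ker n h0 h1).const_mul B
  rw [← hρ] at hker
  have main : ∫ y, (V.indicator (fun _ : EuclideanSpace ℝ (Fin n) => A * κ * ‖d‖ ^ γ / ‖d‖ ^ ρ) y
      - B * (min (‖y‖ ^ 2) 1 / ‖y‖ ^ ρ)) ≤ ∫ y, (gp y / ‖y‖ ^ ρ - G y) := by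
    apply integral_mono (iV.sub hker) (hp.sub hGi)
    intro y
    have hk : 0 ≤ ‖y‖ ^ ρ := by positivity
    simp only [hG, Pi.sub_apply]
    by_cases hy : y ∈ S
    · have e1 : S.indicator F (Rf y) = gq (Rf y) / ‖y‖ ^ ρ := by
        rw [Set.indicator_of_mem ((hRS y).mpr hy)]
        simp [hF]
      have e2 : Sᶜ.indicator F y = 0 := Set.indicator_of_notMem (by simpa using hy) _
      rw [e1, e2, add_zero, ← sub_div]
      have hyn : ‖y‖ < ‖d‖ / 2 := by simpa [hS] using hy
      have h2 := div_le_div_of_nonneg_right (h' y hyn) hk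
      refine le_trans ?_ h2
      rw [sub_div, mul_div_assoc B]
      apply sub_le_sub_right
      by_cases hyV : y ∈ V
      · rw [Set.indicator_of_mem hyV]
        have hyV' : ‖y - (1 / 4 : ℝ) • d‖ < ‖d‖ / 8 := by
          rw [← dist_eq_norm]; exact hyV
        have hin : ‖d‖ ^ 2 / 8 ≤ inner ℝ d y := by
          have e : inner ℝ d y = inner ℝ d (y - (1 / 4 : ℝ) • d) + 1 / 4 * ‖d‖ ^ 2 := by
            rw [inner_sub_right, inner_smul_right, real_inner_self_eq_norm_sq]; ring
          have a1 := abs_real_inner_le_norm d (y - (1 / 4 : ℝ) • d)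
          have a2 := neg_abs_le (inner ℝ d (y - (1 / 4 : ℝ) • d))
          nlinarith
        have hσ : 1 / 4 ≤ 2 * (inner ℝ d y / ‖d‖ ^ 2) := by
          have : 1 / 8 ≤ inner ℝ d y / ‖d‖ ^ 2 := by
            rw [le_div_iff₀ (by positivity)]; linarith
          linarith
        have hσ2 : 1 / 16 ≤ (2 * (inner ℝ d y / ‖d‖ ^ 2)) ^ 2 := by nlinarith
        have hy0 : 0 < ‖y‖ := by
          rw [norm_pos_iff]; rintro rfl
          simp at hin
          nlinarith
        have hle : ‖y‖ ^ ρ ≤ ‖d‖ ^ ρ :=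
          Real.rpow_le_rpow hy0.le (by linarith) hρ0.le
        have hyp : 0 < ‖y‖ ^ ρ := by positivity
        have hdγ : 0 ≤ ‖d‖ ^ γ := by positivity
        have h1γ : 0 < 1 - γ := by linarith
        apply div_le_div₀ (by positivity) _ hyp hle
        have : A * κ * ‖d‖ ^ γ = A * (γ * (1 - γ) / 2 * ‖d‖ ^ γ * (1 / 16)) := by
          rw [hκ]; ring
        rw [this]
        gcongr
      · rw [Set.indicator_of_notMem hyV]
        have h1γ : 0 < 1 - γ := by linarith
        positivity
    · have e1 : S.indicator F (Rf y) = 0 :=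
        Set.indicator_of_notMem (fun hc => hy ((hRS y).mp hc)) _
      have e2 : Sᶜ.indicator F y = gq y / ‖y‖ ^ ρ := Set.indicator_of_mem hy _
      have hyV : y ∉ V := by
        intro hyV
        apply hy
        have hyV' : ‖y - (1 / 4 : ℝ) • d‖ < ‖d‖ / 8 := by
          rw [← dist_eq_norm]; exact hyV
        have : ‖y‖ ≤ ‖y - (1 / 4 : ℝ) • d‖ + ‖(1 / 4 : ℝ) • d‖ := by
          simpa using norm_add_le (y - (1 / 4 : ℝ) • d) ((1 / 4 : ℝ) • d)
        rw [norm_smul] at this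
        norm_num at this
        have : ‖y‖ < ‖d‖ / 2 := by linarith
        simpa [hS] using this
      rw [e1, e2, zero_add, Set.indicator_of_notMem hyV, ← sub_div]
      have h2 := div_le_div_of_nonneg_right (h y) hk
      refine le_trans (le_of_eq ?_) h2
      ring
  rw [integral_sub hp hGi, hGF, integral_sub iV hker, integral_const_mul,
    integral_indicator_const _ hVm, hVr] at main
  refine le_trans ?_ main
  apply sub_le_sub_right
  rw [smul_eq_mul]
  have hpow : 1 ≤ ‖d‖ ^ n * (‖d‖ ^ γ / ‖d‖ ^ ρ) := by
    rw [← Real.rpow_sub hr, ← Real.rpow_natCast, ← Real.rpow_add hr]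
    apply Real.one_le_rpow_of_pos_of_le_one_of_nonpos hr hd1
    rw [hρ]; linarith
  have hω : 0 ≤ volume.real (Metric.ball (0 : EuclideanSpace ℝ (Fin n)) 1) := measureReal_nonneg
  calc A * (κ * (1 / 8) ^ n * volume.real (Metric.ball (0 : EuclideanSpace ℝ (Fin n)) 1))
      = A * (κ * (1 / 8) ^ n * volume.real (Metric.ball (0 : EuclideanSpace ℝ (Fin n)) 1)) * 1 := by ring
    _ ≤ A * (κ * (1 / 8) ^ n * volume.real (Metric.ball (0 : EuclideanSpace ℝ (Fin n)) 1)) *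
        (‖d‖ ^ n * (‖d‖ ^ γ / ‖d‖ ^ ρ)) := by
        apply mul_le_mul_of_nonneg_left hpow
        positivity
    _ = _ := by ring

section grp
variable {ι : Type*} [Fintype ι] [DecidableEq ι]

lemma grpIncl_neg (N : ι → ℕ) (i : ι) (y : EuclideanSpace ℝ (Fin (N i))) :
    grpIncl N i (-y) = - grpIncl N i y := by
  ext j k
  by_cases h : j = i
  · subst h; simp [grpIncl]
  · simp [grpIncl, h]

lemma grpIncl_smul (N : ι → ℕ) (i : ι) (c : ℝ) (y : EuclideanSpace ℝ (Fin (N i))) :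
    grpIncl N i (c • y) = c • grpIncl N i y := by
  ext j k
  by_cases h : j = i
  · subst h; simp [grpIncl]
  · simp [grpIncl, h]

lemma grpIncl_sub (N : ι → ℕ) (i : ι) (y z : EuclideanSpace ℝ (Fin (N i))) :
    grpIncl N i (y - z) = grpIncl N i y - grpIncl N i z := by
  ext j k
  by_cases h : j = i
  · subst h; simp [grpIncl]
  · simp [grpIncl, h]

lemma grpIncl_norm (N : ι → ℕ) (i : ι) (y : EuclideanSpace ℝ (Fin (N i))) :
    ‖grpIncl N i y‖ = ‖y‖ := by
  unfold grpIncl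
  exact PiLp.norm_single 2 (fun i : ι => EuclideanSpace ℝ (Fin (N i))) i y

def phi (N : ι → ℕ) (γ : ℝ) (d : GS N) : ℝ := ∑ j, ‖d j‖ ^ γ

lemma phi_add (N : ι → ℕ) (γ : ℝ) (d : GS N) (i : ι) (z : EuclideanSpace ℝ (Fin (N i))) :
    phi N γ (d + grpIncl N i z) = phi N γ d - ‖d i‖ ^ γ + ‖d i + z‖ ^ γ := by
  unfold phi
  rw [← Finset.add_sum_erase _ _ (Finset.mem_univ i), ← Finset.add_sum_erase _ (fun j => ‖d j‖ ^ γ) (Finset.mem_univ i)]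
  have : ∑ x ∈ Finset.univ.erase i, ‖(d + grpIncl N i z) x‖ ^ γ =
      ∑ x ∈ Finset.univ.erase i, ‖d x‖ ^ γ := by
    apply Finset.sum_congr rfl
    intro j hj
    have hj' : j ≠ i := Finset.ne_of_mem_erase hj
    simp [grpIncl, hj']
  rw [this]
  have h2 : (d + grpIncl N i z) i = d i + z := by simp [grpIncl]
  rw [h2]
  ring

/-- Jump inequality in the group `i`. -/
def Jump (N : ι → ℕ) (i : ι) (γ A B : ℝ) (u : GS N → ℝ) (p q : GS N) : Prop :=
  ∀ y y' : EuclideanSpace ℝ (Fin (N i)),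
    A * (2 * ‖(p - q) i‖ ^ γ - ‖(p - q) i + (y - y')‖ ^ γ - ‖(p - q) i - (y - y')‖ ^ γ)
      - B * min (‖y‖ ^ 2) 1 ≤
    (2 * u p - u (p + grpIncl N i y) - u (p - grpIncl N i y)) -
      (2 * u q - u (q + grpIncl N i y') - u (q - grpIncl N i y'))

lemma group_nonloc (N : ι → ℕ) (i : ι) {s γ : ℝ} (h0 : 0 < s) (h1 : s < 1)
    (hγ0 : 0 < γ) (hγ1 : γ < 1) (hγs : γ ≤ 2 * s) :
    ∃ κ > 0, ∃ Λ ≥ 0, ∀ (A B : ℝ) (u : GS N → ℝ) (p q : GS N), 0 ≤ A →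
      Jump N i γ A B u p q → gInt N i s u p → gInt N i s u q →
      -(B * Λ) ≤ gLap N i s u p - gLap N i s u q ∧
      ((p - q) i ≠ 0 → ‖(p - q) i‖ ≤ 1 →
        A * κ - B * Λ ≤ gLap N i s u p - gLap N i s u q) := by
  have hc := cns_pos (N i) h0 h1
  set I := ∫ y : EuclideanSpace ℝ (Fin (N i)), min (‖y‖ ^ 2) 1 / ‖y‖ ^ (((N i : ℕ) : ℝ) + 2 * s)
    with hI
  have hI0 : 0 ≤ I := integral_nonneg (fun y => by positivity)
  have h1γ : 0 < 1 - γ := by linarith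
  have hω : 0 < volume.real (Metric.ball (0 : EuclideanSpace ℝ (Fin (N i))) 1) :=
    ENNReal.toReal_pos (Metric.measure_ball_pos _ _ one_pos).ne' measure_ball_lt_top.ne
  refine ⟨cns (N i) s * (γ * (1 - γ) / 2 / 16 * (1 / 8) ^ (N i) *
        volume.real (Metric.ball (0 : EuclideanSpace ℝ (Fin (N i))) 1)), by positivity,
    cns (N i) s * I, by positivity, ?_⟩
  intro A B u p q hA J hp hq
  have hp' := hp.resolve_left h1.ne
  have hq' := hq.resolve_left h1.ne
  have hsync : ∀ y : EuclideanSpace ℝ (Fin (N i)), -(B * min (‖y‖ ^ 2) 1) ≤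
      (2 * u p - u (p + grpIncl N i y) - u (p - grpIncl N i y)) -
      (2 * u q - u (q + grpIncl N i y) - u (q - grpIncl N i y)) := by
    intro y
    have := J y y
    rw [sub_self y, add_zero, sub_zero] at this
    refine le_trans (le_of_eq ?_) this
    ring
  simp only [gLap, h1.ne, if_false]
  constructor
  · have := mul_le_mul_of_nonneg_left (nonloc_sync h0 h1 _ _ hp' hq' hsync) hc.le
    rw [mul_sub] at this
    refine le_trans (le_of_eq ?_) this
    rw [hI]; ring
  · intro hd hd1
    have := mul_le_mul_of_nonneg_left
      (nonloc_refl h0 h1 hA hγ0 hγ1 hγs _ _ hp' hq' ((p - q) i) hd hd1 hsync ?_) hc.le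
    · rw [mul_sub (cns (N i) s) (∫ _, _)] at this
      refine le_trans (le_of_eq ?_) this
      rw [hI]; ring
    · intro y hy
      have hr : 0 < ‖(p - q) i‖ := norm_pos_iff.mpr hd
      set d := (p - q) i with hdd
      set σ : ℝ := 2 * (inner ℝ d y / ‖d‖ ^ 2) with hσ
      have hσ1 : |σ| < 1 := by
        rw [hσ, abs_mul, abs_div, abs_of_pos (by positivity : 0 < ‖d‖ ^ 2), abs_two,
          ← mul_div_assoc, div_lt_one (by positivity)]
        have := abs_real_inner_le_norm d y
        nlinarith
      have hR : (Submodule.span ℝ {d}).reflection y = -(y - σ • d) := by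
        rw [Submodule.reflection_singleton_apply, hσ]
        simp only [RCLike.ofReal_real_eq_id, id, mul_smul, two_smul]
        abel
      have h3 := J y (y - σ • d)
      rw [← hdd, sub_sub_cancel] at h3
      rw [hR, grpIncl_neg]
      have h4 := mul_le_mul_of_nonneg_left (norm_aux hγ0 hγ1 d hσ1) hA
      rw [sub_neg_eq_add, ← sub_eq_add_neg]
      linarith

lemma group_loc (N : ι → ℕ) (i : ι) (hN : N i = 1) {γ : ℝ}
    (hγ0 : 0 < γ) (hγ1 : γ < 1) :
    ∃ κ > 0, ∃ Λ ≥ 0, ∀ (A B : ℝ) (u : GS N → ℝ) (p q : GS N), 0 ≤ A → 0 ≤ B →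
      Jump N i γ A B u p q → ContDiffAt ℝ 2 u p → ContDiffAt ℝ 2 u q →
      -(B * Λ) ≤ gLap N i 1 u p - gLap N i 1 u q ∧
      ((p - q) i ≠ 0 → ‖(p - q) i‖ ≤ 1 →
        A * κ - B * Λ ≤ gLap N i 1 u p - gLap N i 1 u q) := by
  have h1γ : 0 < 1 - γ := by linarith
  refine ⟨γ * (1 - γ) / 2 * 4, by positivity, 1, zero_le_one, ?_⟩
  intro A B u p q hA hB J hp hq
  obtain ⟨j, hj⟩ : ∃ j : Fin (N i), ∀ k, k = j :=
    ⟨⟨0, by omega⟩, fun k => by ext; have := k.2; simp; omega⟩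
  have huniv : (Finset.univ : Finset (Fin (N i))) = {j} := by
    ext k; simp [hj k]
  simp only [gLap, if_true, huniv, Finset.sum_singleton]
  set b : EuclideanSpace ℝ (Fin (N i)) := EuclideanSpace.single j 1 with hb
  have hbn : ‖b‖ = 1 := by simp [hb]
  set e := grpIncl N i b with he
  have hline : ∀ x : GS N, ContDiffAt ℝ 2 u x → ContDiffAt ℝ 2 (fun t : ℝ => u (x + t • e)) 0 := by
    intro x hx
    have hx' : ContDiffAt ℝ 2 u (x + (0 : ℝ) • e) := by simpa using hx
    exact ContDiffAt.comp (0 : ℝ) (f := fun t : ℝ => x + t • e) hx'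
      (contDiffAt_const.add (contDiffAt_id.smul contDiffAt_const))
  have key : ∀ k : ℝ, (∀ᶠ t in nhds (0 : ℝ), (u (p + t • e) + u (p - t • e) - 2 * u p) -
      (u (q + t • e) + u (q - t • e) - 2 * u q) ≤ k * t ^ 2) → dirD2 u p e - dirD2 u q e ≤ k := by
    intro k hk
    apply second_aux _ _ k (hline p hp) (hline q hq)
    filter_upwards [hk] with t ht
    simpa [← sub_eq_add_neg] using ht
  have hte : ∀ t : ℝ, grpIncl N i (t • b) = t • e := fun t => grpIncl_smul N i t b
  have hmin : ∀ t : ℝ, B * min (‖t • b‖ ^ 2) 1 ≤ B * t ^ 2 := by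
    intro t
    apply mul_le_mul_of_nonneg_left _ hB
    refine (min_le_left _ _).trans ?_
    rw [norm_smul, hbn]; simp
  constructor
  · have := key B (Eventually.of_forall fun t => by
      have h3 := J (t • b) (t • b)
      rw [sub_self, add_zero, sub_zero, hte] at h3
      have := hmin t
      linarith)
    linarith
  · intro hd hd1
    set d := (p - q) i with hdd
    have hr : 0 < ‖d‖ := norm_pos_iff.mpr hd
    have hdb : d = (d j) • b := by
      ext k
      rw [hj k]; simp [hb]
    have hdj : ‖d‖ = |d j| := by
      conv_lhs => rw [hdb]
      rw [norm_smul, hbn]; simp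
    have hdj0 : d j ≠ 0 := by
      intro h; rw [h, abs_zero] at hdj; linarith
    have := key (B - A * (γ * (1 - γ) / 2 * 4)) (by
      have hev : ∀ᶠ t in nhds (0 : ℝ), |t| < ‖d‖ / 2 := by
        have : Tendsto (fun t : ℝ => |t|) (nhds 0) (nhds 0) := by
          simpa using (continuous_abs.tendsto (0 : ℝ))
        exact this.eventually (gt_mem_nhds (by positivity))
      filter_upwards [hev] with t ht
      have h3 := J (t • b) (-(t • b))
      rw [sub_neg_eq_add, ← hdd, grpIncl_neg, hte] at h3
      set σ : ℝ := 2 * t / d j with hσ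
      have hz : t • b + t • b = σ • d := by
        rw [hdb, smul_smul, ← add_smul]
        congr 1
        rw [hσ]; field_simp; ring
      have hσ1 : |σ| < 1 := by
        rw [hσ, abs_div, ← hdj, div_lt_one hr, abs_mul, abs_two]; linarith
      rw [hz] at h3
      have h4 := mul_le_mul_of_nonneg_left (norm_aux hγ0 hγ1 d hσ1) hA
      have h5 : 4 * t ^ 2 ≤ ‖d‖ ^ γ * σ ^ 2 := by
        have e1 : ‖d‖ ^ 2 ≤ ‖d‖ ^ γ := by
          rw [← Real.rpow_natCast]
          apply Real.rpow_le_rpow_of_exponent_ge hr hd1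
          push_cast; linarith
        have e2 : ‖d‖ ^ 2 * σ ^ 2 = 4 * t ^ 2 := by
          rw [hdj, sq_abs, hσ]; field_simp; ring
        rw [← e2]
        exact mul_le_mul_of_nonneg_right e1 (sq_nonneg _)
      have h6 : A * (γ * (1 - γ) / 2) * (4 * t ^ 2) ≤ A * (γ * (1 - γ) / 2) * (‖d‖ ^ γ * σ ^ 2) :=
        mul_le_mul_of_nonneg_left h5 (by positivity)
      have := hmin t
      rw [sub_neg_eq_add, ← sub_eq_add_neg] at h3
      nlinarith)
    linarith

end grp

lemma psi_aux {E : Type*} [NormedAddCommGroup E] [InnerProductSpace ℝ E] (z y : E)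
    (hz : ‖z‖ ^ 2 ≤ 1 / 64) :
    min (‖z + y‖ ^ 2) (1 / 64) + min (‖z - y‖ ^ 2) (1 / 64) ≤
      2 * min (‖z‖ ^ 2) (1 / 64) + 2 * min (‖y‖ ^ 2) 1 := by
  rw [min_eq_left hz]
  have hp := parallelogram_law_with_norm ℝ z y
  have a1 := min_le_left (‖z + y‖ ^ 2) (1 / 64)
  have a2 := min_le_right (‖z + y‖ ^ 2) (1 / 64)
  have b1 := min_le_left (‖z - y‖ ^ 2) (1 / 64)
  have b2 := min_le_right (‖z - y‖ ^ 2) (1 / 64)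
  have := sq_nonneg ‖z‖
  rcases min_choice (‖y‖ ^ 2) 1 with h | h <;> rw [h] <;> nlinarith

lemma norm_le_sum {m : ℕ} (N : Fin (m + 1) → ℕ) (d : GS N) : ‖d‖ ≤ ∑ j, ‖d j‖ := by
  have : d = ∑ j, grpIncl N j (d j) := by
    ext i k
    simp only [grpIncl, WithLp.ofLp_sum, Finset.sum_apply]
    rw [Finset.sum_eq_single i]
    · simp
    · intro b _ hb
      simp [Pi.single_eq_of_ne (Ne.symm hb)]
    · simp
  conv_lhs => rw [this]
  refine (norm_sum_le _ _).trans (le_of_eq ?_)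
  apply Finset.sum_congr rfl
  intro j _
  exact grpIncl_norm N j _

lemma norm_sub_grp {m : ℕ} (N : Fin (m + 1) → ℕ) (x : GS N) (i : Fin (m + 1)) :
    ‖x - grpIncl N i (x i)‖ ≤ ‖x‖ := by
  rw [PiLp.norm_eq_of_L2, PiLp.norm_eq_of_L2]
  apply Real.sqrt_le_sqrt
  apply Finset.sum_le_sum
  intro j _
  by_cases h : j = i
  · subst h
    have : (x - grpIncl N j (x j)) j = 0 := by simp [grpIncl]
    rw [this]; simp
  · have : (x - grpIncl N i (x i)) j = x j := by simp [grpIncl, h]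
    rw [this]

lemma core {m : ℕ} (N : Fin (m + 1) → ℕ) (s : Fin (m + 1) → ℝ) (a : Fin (m + 1) → ℝ)
    (ha : ∀ i, 0 < a i) {γ : ℝ} (hγ0 : 0 < γ) (hγ1 : γ < 1)
    (κ Λ : Fin (m + 1) → ℝ) (hκ : ∀ i, 0 < κ i) (hΛ : ∀ i, 0 ≤ Λ i)
    (hgrp : ∀ i, ∀ (A B : ℝ) (u : GS N → ℝ) (p q : GS N), 0 ≤ A → 0 ≤ B →
      Jump N i γ A B u p q → (ContDiffAt ℝ 2 u p ∧ ∀ i, gInt N i (s i) u p) →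
      (ContDiffAt ℝ 2 u q ∧ ∀ i, gInt N i (s i) u q) →
      -(B * Λ i) ≤ gLap N i (s i) u p - gLap N i (s i) u q ∧
      ((p - q) i ≠ 0 → ‖(p - q) i‖ ≤ 1 →
        A * κ i - B * Λ i ≤ gLap N i (s i) u p - gLap N i (s i) u q))
    (u f : GS N → ℝ) (Mf K Mu : ℝ) (hf : ∀ x, |f x| ≤ Mf) (hK : 0 ≤ K) (hu : ∀ x, |u x| ≤ Mu)
    (hsol : IsSol N a s u f
        {x : GS N | ‖x - grpIncl N (Fin.last m) (x (Fin.last m))‖ < 1})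
    (A : ℝ) (hA1 : 2 * Mu ≤ A * (1 / (8 * ((m : ℝ) + 1))) ^ γ)
    (hA2 : ∀ i, 2 * Mf + 256 * Mu * (∑ j, a j * Λ j) + Mu ≤ A * (a i * κ i))
    (x₀ : GS N) (hx₀ : ‖x₀‖ < 1 / 2) (q₀ : GS N) :
    u x₀ - u q₀ ≤ A * phi N γ (x₀ - q₀) := by
  by_contra! hlt
  have hMu : 0 ≤ Mu := (abs_nonneg _).trans (hu 0)
  have hMf : 0 ≤ Mf := (abs_nonneg _).trans (hf 0)
  set ρ : ℝ := 1 / (8 * ((m : ℝ) + 1)) with hρ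
  have hρ0 : 0 < ρ := by positivity
  have hρ1 : ρ ≤ 1 := by
    rw [hρ, div_le_one (by positivity)]
    have : (0 : ℝ) ≤ m := by positivity
    linarith
  have hργ : 0 < ρ ^ γ := by positivity
  have hA : 0 ≤ A := by
    by_contra! hneg
    nlinarith
  have huu : ∀ p q, u p - u q ≤ 2 * Mu := by
    intro p q
    have := (abs_le.mp (hu p)).2
    have := (abs_le.mp (hu q)).1
    linarith
  set ψ : GS N → ℝ := fun p => min (‖p - x₀‖ ^ 2) (1 / 64) with hψ
  have hψ0 : ∀ p, 0 ≤ ψ p := fun p => by simp only [hψ]; positivity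
  have hphi0 : ∀ d : GS N, 0 ≤ phi N γ d := fun d =>
    Finset.sum_nonneg (fun j _ => by positivity)
  set Ψ : GS N × GS N → ℝ := fun z =>
    u z.1 - u z.2 - A * phi N γ (z.1 - z.2) - 128 * Mu * ψ z.1 with hΨ
  have hΨc : Continuous Ψ := by
    have hc := hsol.1
    have hphic : Continuous (phi N γ) := by
      unfold phi
      refine continuous_finsetSum _ (fun j _ => ?_)
      exact Continuous.rpow_const (by fun_prop) (fun _ => Or.inr hγ0.le)
    simp only [hΨ, hψ]
    exact (((hc.comp continuous_fst).sub (hc.comp continuous_snd)).sub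
      (continuous_const.mul (hphic.comp (continuous_fst.sub continuous_snd)))).sub (by fun_prop)
  -- positivity localizes
  have hloc : ∀ p q, 0 < Ψ (p, q) → ‖p - x₀‖ < 1 / 8 ∧ (∀ j, ‖(p - q) j‖ < ρ) ∧ 0 < Mu := by
    intro p q h
    simp only [hΨ] at h
    have h1 := huu p q
    have h2 := mul_nonneg hA (hphi0 (p - q))
    have h3 := mul_nonneg hMu (hψ0 p)
    refine ⟨?_, ?_, ?_⟩
    · by_contra! hge
      have : ψ p = 1 / 64 := min_eq_right (by nlinarith)
      rw [this] at h
      linarith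
    · intro j
      by_contra! hge
      have e1 : ρ ^ γ ≤ ‖(p - q) j‖ ^ γ := Real.rpow_le_rpow hρ0.le hge hγ0.le
      have e2 : ‖(p - q) j‖ ^ γ ≤ phi N γ (p - q) :=
        Finset.single_le_sum (f := fun j => ‖(p - q) j‖ ^ γ)
          (fun j _ => by positivity) (Finset.mem_univ j)
      have e3 := mul_le_mul_of_nonneg_left (e1.trans e2) hA
      linarith
    · linarith
  have hpq : ∀ p q : GS N, (∀ j, ‖(p - q) j‖ < ρ) → ‖p - q‖ ≤ 1 / 8 := by
    intro p q h
    refine (norm_le_sum N (p - q)).trans ?_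
    refine (Finset.sum_le_sum (fun j _ => (h j).le)).trans (le_of_eq ?_)
    simp [hρ]
    field_simp
  have hcomp : IsCompact (Metric.closedBall x₀ (1 / 8) ×ˢ Metric.closedBall x₀ (1 / 4) :
      Set (GS N × GS N)) :=
    (isCompact_closedBall _ _).prod (isCompact_closedBall _ _)
  have hmem : ∀ p q, 0 < Ψ (p, q) →
      (p, q) ∈ (Metric.closedBall x₀ (1 / 8) ×ˢ Metric.closedBall x₀ (1 / 4) :
      Set (GS N × GS N)) := by
    intro p q h
    obtain ⟨h1, h2, -⟩ := hloc p q h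
    have h3 := hpq p q h2
    refine ⟨?_, ?_⟩
    · simp only [Metric.mem_closedBall, dist_eq_norm]; exact h1.le
    · simp only [Metric.mem_closedBall, dist_eq_norm]
      have : q - x₀ = (p - x₀) - (p - q) := by abel
      rw [this]
      refine (norm_sub_le _ _).trans ?_
      linarith
  have hpos0 : 0 < Ψ (x₀, q₀) := by
    simp only [hΨ, hψ]
    simp
    linarith
  obtain ⟨⟨p, q⟩, hzm, hmax⟩ := hcomp.exists_isMaxOn ⟨_, hmem _ _ hpos0⟩ hΨc.continuousOn
  have hpos : 0 < Ψ (p, q) := lt_of_lt_of_le hpos0 (hmax (hmem _ _ hpos0))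
  have hmax' : ∀ p' q', Ψ (p', q') ≤ Ψ (p, q) := by
    intro p' q'
    rcases le_or_gt (Ψ (p', q')) 0 with h | h
    · exact h.trans hpos.le
    · exact hmax (hmem _ _ h)
  obtain ⟨h1, h2, hMu0⟩ := hloc p q hpos
  have h3 := hpq p q h2
  -- membership in the domain
  have hpn : ‖p‖ < 1 := by
    have : p = (p - x₀) + x₀ := by abel
    rw [this]
    refine (norm_add_le _ _).trans_lt ?_
    linarith
  have hqn : ‖q‖ < 1 := by
    have : q = (p - x₀) + x₀ - (p - q) := by abel
    rw [this]
    refine (norm_sub_le _ _).trans_lt ?_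
    have := norm_add_le (p - x₀) x₀
    linarith
  obtain ⟨hp1, hp2, hp3⟩ := hsol.2 p ((norm_sub_grp N p _).trans_lt hpn)
  obtain ⟨hq1, hq2, hq3⟩ := hsol.2 q ((norm_sub_grp N q _).trans_lt hqn)
  have hne : ∃ i, (p - q) i ≠ 0 := by
    by_contra! hall
    have : p - q = 0 := by
      ext j k
      rw [hall j]; simp
    have hpq' : p = q := sub_eq_zero.mp this
    subst hpq'
    simp only [hΨ] at hpos
    have e2 := mul_nonneg hA (hphi0 (p - p))
    have e3 := mul_nonneg hMu (hψ0 p)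
    linarith
  obtain ⟨i, hi⟩ := hne
  have hJ : ∀ i, Jump N i γ A (256 * Mu) u p q := by
    intro i y y'
    set Y := grpIncl N i y with hY
    set Y' := grpIncl N i y' with hY'
    have m1 := hmax' (p + Y) (q + Y')
    have m2 := hmax' (p - Y) (q - Y')
    simp only [hΨ] at m1 m2
    have d1 : p + Y - (q + Y') = (p - q) + grpIncl N i (y - y') := by
      rw [grpIncl_sub]; abel
    have d2 : p - Y - (q - Y') = (p - q) + grpIncl N i (-(y - y')) := by
      rw [grpIncl_neg, grpIncl_sub]; abel
    rw [d1, phi_add] at m1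
    rw [d2, phi_add, ← sub_eq_add_neg] at m2
    have hps := psi_aux (p - x₀) Y (by
      have := norm_nonneg (p - x₀)
      nlinarith)
    have z1 : p + Y - x₀ = p - x₀ + Y := by abel
    have z2 : p - Y - x₀ = p - x₀ - Y := by abel
    simp only [hψ] at m1 m2
    rw [z1] at m1
    rw [z2] at m2
    rw [hY, grpIncl_norm, ← hY] at hps
    have hps' := mul_le_mul_of_nonneg_left hps (by positivity : 0 ≤ 128 * Mu)
    nlinarith
  have hterm : ∀ j, -(256 * Mu * Λ j) + (if j = i then A * κ i else 0) ≤
      gLap N j (s j) u p - gLap N j (s j) u q := by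
    intro j
    have hg := hgrp j A (256 * Mu) u p q hA (by positivity) (hJ j) ⟨hp1, hp2⟩ ⟨hq1, hq2⟩
    split_ifs with hji
    · subst hji
      have := hg.2 hi ((h2 j).le.trans hρ1)
      linarith
    · have := hg.1
      linarith
  have hsum : f p - f q = ∑ j, a j * (gLap N j (s j) u p - gLap N j (s j) u q) := by
    rw [← hp3, ← hq3, Lop, Lop, ← Finset.sum_sub_distrib]
    exact Finset.sum_congr rfl (fun j _ => by ring)
  have hlow : ∑ j, a j * (-(256 * Mu * Λ j) + (if j = i then A * κ i else 0)) ≤ f p - f q := by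
    rw [hsum]
    exact Finset.sum_le_sum (fun j _ => mul_le_mul_of_nonneg_left (hterm j) (ha j).le)
  have hcalc : ∑ j, a j * (-(256 * Mu * Λ j) + (if j = i then A * κ i else 0)) =
      A * (a i * κ i) - 256 * Mu * ∑ j, a j * Λ j := by
    simp only [mul_add, Finset.sum_add_distrib, mul_ite, mul_zero, Finset.sum_ite_eq',
      Finset.mem_univ, if_true]
    rw [Finset.mul_sum, add_comm, sub_eq_add_neg, ← Finset.sum_neg_distrib]
    congr 1
    · ring
    · exact Finset.sum_congr rfl (fun j _ => by ring)
  rw [hcalc] at hlow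
  have hff : f p - f q ≤ 2 * Mf := by
    have := (abs_le.mp (hf p)).2
    have := (abs_le.mp (hf q)).1
    linarith
  have := hA2 i
  linarith

/-- Corollary 1.3: Hölder estimate for `L_* u = f` when `f` is
Lipschitz in the `x_n`-variable. -/
theorem stmt2 {m : ℕ} (N : Fin (m + 1) → ℕ) (hN : N (Fin.last m) = 1)
    (s : ℝ) (hs : s ∈ Set.Ioo (0 : ℝ) 1)
    (a : Fin (m + 1) → ℝ) (ha : ∀ i, 0 < a i)
    (γ : ℝ) (hγ : (s < 1 / 2 ∧ γ = 2 * s) ∨ (1 / 2 ≤ s ∧ 0 < γ ∧ γ < 1)) :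
    ∃ C > 0, ∀ (u f : GS N → ℝ) (Mf K Mu : ℝ),
      (∀ x, |f x| ≤ Mf) →
      (∀ (x : GS N) (t : ℝ), x ∈ Metric.ball (0 : GS N) 1 →
        x + t • eN N ∈ Metric.ball (0 : GS N) 1 →
        |f (x + t • eN N) - f x| ≤ K * |t|) →
      (∀ x, |u x| ≤ Mu) →
      IsSol N a (fun i => if i = Fin.last m then 1 else s) u f
        {x : GS N | ‖x - grpIncl N (Fin.last m) (x (Fin.last m))‖ < 1} →
      ∀ x ∈ Metric.ball (0 : GS N) (1 / 2), ∀ y ∈ Metric.ball (0 : GS N) (1 / 2),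
        |u x - u y| ≤ C * (Mf + K + Mu) * ‖x - y‖ ^ γ := by
  obtain ⟨hs0, hs1⟩ := hs
  obtain ⟨hγ0, hγ1, hγs⟩ : 0 < γ ∧ γ < 1 ∧ γ ≤ 2 * s := by
    rcases hγ with ⟨h1, h2⟩ | ⟨h1, h2, h3⟩
    · refine ⟨?_, ?_, ?_⟩ <;> linarith
    · refine ⟨?_, ?_, ?_⟩ <;> linarith
  set S : Fin (m + 1) → ℝ := fun i => if i = Fin.last m then 1 else s with hS
  have hex : ∀ i, ∃ κ > 0, ∃ Λ ≥ 0, ∀ (A B : ℝ) (u : GS N → ℝ) (p q : GS N), 0 ≤ A → 0 ≤ B →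
      Jump N i γ A B u p q → (ContDiffAt ℝ 2 u p ∧ ∀ i, gInt N i (S i) u p) →
      (ContDiffAt ℝ 2 u q ∧ ∀ i, gInt N i (S i) u q) →
      -(B * Λ) ≤ gLap N i (S i) u p - gLap N i (S i) u q ∧
      ((p - q) i ≠ 0 → ‖(p - q) i‖ ≤ 1 →
        A * κ - B * Λ ≤ gLap N i (S i) u p - gLap N i (S i) u q) := by
    intro i
    by_cases hi : i = Fin.last m
    · have hSi : S i = 1 := by simp [hS, hi]
      obtain ⟨κ, hκ, Λ, hΛ, h⟩ := group_loc N i (by rw [hi, hN]) hγ0 hγ1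
      refine ⟨κ, hκ, Λ, hΛ, ?_⟩
      intro A B u p q hA hB hJ hp hq
      rw [hSi]
      exact h A B u p q hA hB hJ hp.1 hq.1
    · have hSi : S i = s := by simp [hS, hi]
      obtain ⟨κ, hκ, Λ, hΛ, h⟩ := group_nonloc N i hs0 hs1 hγ0 hγ1 hγs
      refine ⟨κ, hκ, Λ, hΛ, ?_⟩
      intro A B u p q hA hB hJ hp hq
      have hp' := hp.2 i
      have hq' := hq.2 i
      rw [hSi] at hp' hq' ⊢
      exact h A B u p q hA hJ hp' hq'
  choose κ hκ Λ hΛ hgrp using hex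
  set T := ∑ j, a j * Λ j with hT
  have hT0 : 0 ≤ T := Finset.sum_nonneg (fun j _ => mul_nonneg (ha j).le (hΛ j))
  set ργ : ℝ := (1 / (8 * ((m : ℝ) + 1))) ^ γ with hργ
  have hργ0 : 0 < ργ := by positivity
  have haκ : ∀ i, 0 < a i * κ i := fun i => mul_pos (ha i) (hκ i)
  set K1 : ℝ := (∑ i, (3 + 256 * T) / (a i * κ i)) + 2 / ργ with hK1
  have hterm0 : ∀ i, 0 ≤ (3 + 256 * T) / (a i * κ i) := fun i =>
    div_nonneg (by positivity) (haκ i).le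
  have hK1a : 2 / ργ ≤ K1 := by
    have : 0 ≤ ∑ i, (3 + 256 * T) / (a i * κ i) := Finset.sum_nonneg (fun i _ => hterm0 i)
    linarith
  have hK1b : ∀ i, (3 + 256 * T) / (a i * κ i) ≤ K1 := by
    intro i
    have h1 : (3 + 256 * T) / (a i * κ i) ≤ ∑ i, (3 + 256 * T) / (a i * κ i) :=
      Finset.single_le_sum (f := fun i => (3 + 256 * T) / (a i * κ i))
        (fun i _ => hterm0 i) (Finset.mem_univ i)
    have : 0 < 2 / ργ := by positivity
    linarith
  have hK10 : 0 < K1 := lt_of_lt_of_le (by positivity) hK1a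
  refine ⟨K1 * ((m : ℝ) + 1), by positivity, ?_⟩
  intro u f Mf K Mu hf hLip hu hsol
  have hMu : 0 ≤ Mu := (abs_nonneg _).trans (hu 0)
  have hMf : 0 ≤ Mf := (abs_nonneg _).trans (hf 0)
  have hK : 0 ≤ K := by
    have hen : ‖eN N‖ = 1 := by
      unfold eN
      rw [grpIncl_norm, EuclideanSpace.norm_eq]
      simp [hN]
    have := hLip 0 (1 / 2) (by simp) (by
      simp [norm_smul, hen]; norm_num)
    have h2 := (abs_nonneg _).trans this
    have h3 : |(1 / 2 : ℝ)| = 1 / 2 := by norm_num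
    rw [h3] at h2
    linarith
  set Q := Mf + K + Mu with hQ
  have hQ0 : 0 ≤ Q := by positivity
  have hone : ∀ x : GS N, ‖x‖ < 1 / 2 → ∀ y, u x - u y ≤ K1 * ((m : ℝ) + 1) * Q * ‖x - y‖ ^ γ := by
    intro x hx y
    have hc := core N S a ha hγ0 hγ1 κ Λ hκ hΛ hgrp u f Mf K Mu hf hK hu hsol (K1 * Q)
      (by
        rw [← hργ]
        have h1 : 2 ≤ K1 * ργ := (div_le_iff₀ hργ0).mp hK1a
        have h2 := mul_le_mul_of_nonneg_right h1 hQ0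
        nlinarith)
      (by
        intro i
        have h1 : 3 + 256 * T ≤ K1 * (a i * κ i) := (div_le_iff₀ (haκ i)).mp (hK1b i)
        have h2 := mul_le_mul_of_nonneg_right h1 hQ0
        rw [← hT]
        have h3 : Mu * T ≤ Q * T := mul_le_mul_of_nonneg_right (by linarith) hT0
        nlinarith)
      x hx y
    refine hc.trans ?_
    have hphi : phi N γ (x - y) ≤ ((m : ℝ) + 1) * ‖x - y‖ ^ γ := by
      unfold phi
      have : ∀ j ∈ (Finset.univ : Finset (Fin (m + 1))),
          ‖(x - y) j‖ ^ γ ≤ ‖x - y‖ ^ γ := fun j _ =>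
        Real.rpow_le_rpow (norm_nonneg _) (PiLp.norm_apply_le (x - y) j) hγ0.le
      refine (Finset.sum_le_sum this).trans (le_of_eq ?_)
      simp
    have := mul_le_mul_of_nonneg_left hphi (mul_nonneg hK10.le hQ0)
    linarith
  intro x hx y hy
  rw [mem_ball_zero_iff] at hx hy
  rw [abs_le]
  constructor
  · have := hone y hy x
    rw [norm_sub_rev] at this
    linarith
  · exact hone x hx y

end
end

section
/- Fix d = (d_1, …, d_m) with all d_i > 0, ν ∈ (0, a) and A_1 > 0. Let u : ℝ^n → ℝ be bounded, and define v : ℝ^{n+1} → ℝ by v(x, t) := u(x + t_+ e_n) - u(x - t_+ e_n), where t_+ := max{t, 0}. Assume A_2 ≥ ‖v‖_{L^∞(ℝ^{n+1})} / min_{1 ≤ i ≤ m}(η_i d_i^{2 s_i}). Then Φ(x, t) ≥ |v(x, t)| for every (x, t) ∈ ℝ^{n+1} ∖ (Q_d × (0, d_m)). -/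
open MeasureTheory Real Filter

noncomputable section

theorem aux_etaC_nonneg (N : ℕ) (s : ℝ) (hs : 0 < s) : 0 ≤ etaC N s := by
  unfold etaC
  have h1 : 0 ≤ Real.Gamma ((N : ℝ) / 2) := Real.Gamma_nonneg_of_nonneg (by positivity)
  have h2 : 0 ≤ Real.Gamma (s + 1) := Real.Gamma_nonneg_of_nonneg (by positivity)
  have h3 : 0 ≤ Real.Gamma (s + (N : ℝ) / 2) := Real.Gamma_nonneg_of_nonneg (by positivity)
  positivity

theorem aux_etaC_one : etaC 1 1 = 1 / 2 := by
  unfold etaC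
  have h0 : Real.Gamma (1 / 2 : ℝ) ≠ 0 := (Real.Gamma_pos_of_pos (by norm_num)).ne'
  have h : Real.Gamma (1 + 1 / 2 : ℝ) = 1 / 2 * Real.Gamma (1 / 2) := by
    rw [add_comm]; exact Real.Gamma_add_one (by norm_num)
  have h2 : Real.Gamma (1 + 1 : ℝ) = 1 := by
    rw [Real.Gamma_add_one one_ne_zero, Real.Gamma_one, mul_one]
  have h4 : (2 : ℝ) ^ (2 * 1 : ℝ) = 4 := by
    rw [show (2 * 1 : ℝ) = ((2 : ℕ) : ℝ) by norm_num, Real.rpow_natCast]; norm_num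
  rw [Nat.cast_one, h, h2, h4]
  field_simp
  norm_num

/-- formula (2.11): the barrier dominates `|v|` outside
`Q_d × (0, d_m)`. -/
theorem stmt11 {m : ℕ} (N : Fin (m + 1) → ℕ) (hN : N (Fin.last m) = 1)
    (s : Fin (m + 1) → ℝ) (hs : ∀ i, s i ∈ Set.Ioc (0 : ℝ) 1)
    (hsl : s (Fin.last m) = 1)
    (a : Fin (m + 1) → ℝ) (hal : 0 < a (Fin.last m))
    (d : Fin (m + 1) → ℝ) (hd : ∀ i, 0 < d i)
    (ν : ℝ) (hν : ν ∈ Set.Ioo 0 (a (Fin.last m)))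
    (A₁ A₂ : ℝ) (hA₁ : 0 < A₁) (hA₂pos : 0 < A₂)
    (u : GS N → ℝ) (Mu : ℝ) (hMu : ∀ x, |u x| ≤ Mu)
    (hA₂ : ∀ p : GS N × ℝ,
      |u (p.1 + max p.2 0 • eN N) - u (p.1 - max p.2 0 • eN N)| ≤
        A₂ * ⨅ i, etaC (N i) (s i) * d i ^ (2 * s i)) :
    ∀ p : GS N × ℝ, p ∉ (Qset N d 1) ×ˢ (Set.Ioo (0 : ℝ) (d (Fin.last m))) →
      |u (p.1 + max p.2 0 • eN N) - u (p.1 - max p.2 0 • eN N)| ≤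
        PhiBar N s d ν A₁ A₂ p := by
  intro p hp
  have hη : ∀ i, 0 ≤ etaC (N i) (s i) := fun i => aux_etaC_nonneg _ _ (hs i).1
  have hgf : ∀ i, etaC (N i) (s i) * max (d i ^ 2 - ‖p.1 i‖ ^ 2) 0 ^ s i ≤
      etaC (N i) (s i) * d i ^ (2 * s i) := by
    intro i
    refine mul_le_mul_of_nonneg_left ?_ (hη i)
    have : d i ^ (2 * s i) = (d i ^ 2) ^ s i := by
      rw [Real.rpow_mul (hd i).le, Real.rpow_two]
    rw [this]
    refine Real.rpow_le_rpow (le_max_right _ _) ?_ (hs i).1.le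
    exact max_le (by nlinarith [sq_nonneg ‖p.1 i‖]) (sq_nonneg _)
  have hsum : (∑ i, etaC (N i) (s i) * max (d i ^ 2 - ‖p.1 i‖ ^ 2) 0 ^ s i) ≤
      ∑ i, etaC (N i) (s i) * d i ^ (2 * s i) := Finset.sum_le_sum fun i _ => hgf i
  have ht : max (d (Fin.last m) ^ 2 - p.2 ^ 2) 0 ≤ d (Fin.last m) ^ 2 :=
    max_le (by nlinarith [sq_nonneg p.2]) (sq_nonneg _)
  have h1 : 0 ≤ A₁ / ν * (max p.2 0 * max (d (Fin.last m) - p.2) 0 / 2) := by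
    have := hν.1
    have a1 := le_max_right p.2 0
    have a2 := le_max_right (d (Fin.last m) - p.2) 0
    positivity
  have hinf : ∀ i, (⨅ i, etaC (N i) (s i) * d i ^ (2 * s i)) ≤
      etaC (N i) (s i) * d i ^ (2 * s i) := fun i =>
    ciInf_le (Set.finite_range _).bddBelow i
  unfold PhiBar
  by_cases ht0 : p.2 ≤ 0
  · rw [max_eq_right ht0] at h1 ⊢
    simp only [zero_smul, add_zero, sub_zero, sub_self, abs_zero]
    refine add_nonneg h1 (mul_nonneg hA₂pos.le ?_)
    linarith
  push Not at ht0
  refine (hA₂ p).trans ?_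
  refine le_trans ?_ (le_add_of_nonneg_left h1)
  refine mul_le_mul_of_nonneg_left ?_ hA₂pos.le
  by_cases htd : d (Fin.last m) ≤ p.2
  · have e := hinf (Fin.last m)
    rw [hN, hsl, aux_etaC_one, mul_one, Real.rpow_two] at e
    have : max (d (Fin.last m) ^ 2 - p.2 ^ 2) 0 = 0 := by
      apply max_eq_right
      nlinarith [hd (Fin.last m)]
    rw [this]
    linarith
  push Not at htd
  obtain ⟨j, hj⟩ : ∃ j, d j ≤ ‖p.1 j‖ := by
    by_contra! hc
    exact hp ⟨⟨fun i _ => hc i, by simpa using hc (Fin.last m)⟩, ht0, htd⟩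
  have hz : etaC (N j) (s j) * max (d j ^ 2 - ‖p.1 j‖ ^ 2) 0 ^ s j = 0 := by
    rw [max_eq_right (by nlinarith [hd j]), Real.zero_rpow (hs j).1.ne', mul_zero]
  have hs1 := Finset.single_le_sum (f := fun i => etaC (N i) (s i) * d i ^ (2 * s i) -
      etaC (N i) (s i) * max (d i ^ 2 - ‖p.1 i‖ ^ 2) 0 ^ s i)
    (fun i _ => sub_nonneg.2 (hgf i)) (Finset.mem_univ j)
  simp only [hz, Finset.sum_sub_distrib] at hs1
  linarith [hinf j]

end
end

section
/- Fix d = (d_1, …, d_m) with all d_i > 0 and ν ∈ (0, a). Let h : ℝ^{n+1} → ℝ be continuous, bounded, and satisfy h ≥ 0 on ℝ^{n+1} ∖ (Q_d × (0, d_m)). Assume that h is twice differentiable at every point of Q_d × (0, d_m), that the integrals defining each (-Δ_{X_i})^{s_i} h converge absolutely at every point of Q_d × (0, d_m), and that L_* h(p) > 0 for every p ∈ Q_d × (0, d_m). Then h ≥ 0 on all of ℝ^{n+1}. -/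
open MeasureTheory Real Filter

noncomputable section

lemma d2_nonneg_aux (f : ℝ → ℝ) (hc : ContinuousAt f 0) (hm : ∀ t, f 0 ≤ f t) :
    0 ≤ iteratedDeriv 2 f 0 := by
  rw [iteratedDeriv_succ, iteratedDeriv_one]
  by_contra hneg
  push Not at hneg
  have hmin : IsLocalMin f 0 := Filter.Eventually.of_forall hm
  have hmax := isLocalMax_of_deriv_deriv_neg hneg hmin.deriv_eq_zero hc
  have heq : f =ᶠ[nhds 0] fun _ => f 0 := by
    filter_upwards [hmax] with t ht
    exact le_antisymm ht (hm t)
  have h2 := heq.deriv.deriv_eq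
  simp at h2
  linarith

lemma dirD2_nonneg_aux {E : Type*} [NormedAddCommGroup E] [NormedSpace ℝ E]
    (u : E → ℝ) (hu : Continuous u) (x v : E) (hm : ∀ z, u x ≤ u z) :
    0 ≤ dirD2 u x v := by
  unfold dirD2
  apply d2_nonneg_aux
  · exact (by fun_prop : Continuous (fun t : ℝ => u (x + t • v))).continuousAt
  · intro t
    simpa using hm _

lemma gLap_nonpos_aux {ι : Type*} [Fintype ι] [DecidableEq ι] (N : ι → ℕ) (i : ι) (si : ℝ)
    (hsi : 0 < si) (u : GS N → ℝ) (hu : Continuous u) (x : GS N) (hm : ∀ z, u x ≤ u z) :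
    gLap N i si u x ≤ 0 := by
  unfold gLap
  split_ifs with h1
  · rw [neg_nonpos]
    exact Finset.sum_nonneg fun j _ => dirD2_nonneg_aux u hu x _ hm
  · apply mul_nonpos_of_nonneg_of_nonpos
    · unfold cns
      have := Real.Gamma_pos_of_pos (show 0 < si + (N i : ℝ) / 2 by positivity)
      positivity
    · apply integral_nonpos
      intro y
      apply div_nonpos_of_nonpos_of_nonneg
      · have h1 := hm (x + grpIncl N i y)
        have h2 := hm (x - grpIncl N i y)
        simp only [Pi.zero_apply] 
        linarith
      · positivity

/-- maximum principle, formula (2.12): if `h ≥ 0` outside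
`Q_d × (0,d_m)` and `L_* h > 0` inside, then `h ≥ 0` everywhere. -/
theorem stmt12 {m : ℕ} (N : Fin (m + 1) → ℕ) (hN : N (Fin.last m) = 1)
    (s : Fin (m + 1) → ℝ) (hs : ∀ i, s i ∈ Set.Ioc (0 : ℝ) 1)
    (hsl : s (Fin.last m) = 1)
    (a : Fin (m + 1) → ℝ) (ha : ∀ i, 0 ≤ a i) (hal : 0 < a (Fin.last m))
    (d : Fin (m + 1) → ℝ) (hd : ∀ i, 0 < d i)
    (ν : ℝ) (hν : ν ∈ Set.Ioo 0 (a (Fin.last m)))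
    (h : GS N × ℝ → ℝ) (hcont : Continuous h)
    (Mh : ℝ) (hbd : ∀ p, |h p| ≤ Mh)
    (hout : ∀ p : GS N × ℝ,
      p ∉ (Qset N d 1) ×ˢ (Set.Ioo (0 : ℝ) (d (Fin.last m))) → 0 ≤ h p)
    (hreg : ∀ p ∈ (Qset N d 1) ×ˢ (Set.Ioo (0 : ℝ) (d (Fin.last m))),
      ContDiffAt ℝ 2 h p)
    (hint : ∀ p ∈ (Qset N d 1) ×ˢ (Set.Ioo (0 : ℝ) (d (Fin.last m))),
      ∀ i ∈ Finset.univ.erase (Fin.last m),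
        gInt N i (s i) (fun z => h (z, p.2)) p.1)
    (hpos : ∀ p ∈ (Qset N d 1) ×ˢ (Set.Ioo (0 : ℝ) (d (Fin.last m))),
      0 < LstarOp N a s ν h p) :
    ∀ p : GS N × ℝ, 0 ≤ h p := by
  by_contra hcon
  push Not at hcon
  obtain ⟨p0, hp0⟩ := hcon
  set Q := (Qset N d 1) ×ˢ (Set.Ioo (0 : ℝ) (d (Fin.last m))) with hQ
  have hp0Q : p0 ∈ Q := by
    by_contra hn
    linarith [hout p0 hn]
  have hbound : ∃ R : ℝ, Q ⊆ Metric.closedBall 0 R := by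
    refine ⟨(∑ i, d i) + d (Fin.last m), ?_⟩
    rintro ⟨x, t⟩ ⟨hx, ht⟩
    have hsum : 0 ≤ ∑ i, d i := Finset.sum_nonneg fun i _ => (hd i).le
    have hi : ∀ i, ‖x i‖ ≤ d i := by
      intro i
      by_cases hil : i = Fin.last m
      · subst hil
        have := hx.2
        linarith
      · exact (hx.1 i hil).le
    rw [mem_closedBall_zero_iff, Prod.norm_mk, max_le_iff]
    constructor
    · have h1 : ‖x‖ ≤ ∑ i, d i := by
        rw [PiLp.norm_eq_of_L2]
        apply Real.sqrt_le_iff.mpr ⟨hsum, ?_⟩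
        calc ∑ i, ‖x i‖ ^ 2 ≤ ∑ i, d i ^ 2 :=
              Finset.sum_le_sum fun i _ => pow_le_pow_left₀ (norm_nonneg _) (hi i) 2
          _ ≤ (∑ i, d i) ^ 2 := Finset.sum_sq_le_sq_sum_of_nonneg fun i _ => (hd i).le
      linarith [hd (Fin.last m)]
    · have h1 : 0 < t := ht.1
      have h2 : t < d (Fin.last m) := ht.2
      rw [Real.norm_eq_abs, abs_of_pos h1]
      linarith
  obtain ⟨R, hR⟩ := hbound
  obtain ⟨p, hpK, hpmin⟩ := (isCompact_closedBall (0 : GS N × ℝ) R).exists_isMinOn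
    ⟨p0, hR hp0Q⟩ hcont.continuousOn
  have hple : h p ≤ h p0 := hpmin (hR hp0Q)
  have hpQ : p ∈ Q := by
    by_contra hn
    linarith [hout p hn]
  have hmin : ∀ q, h p ≤ h q := by
    intro q
    by_cases hq : q ∈ Q
    · exact hpmin (hR hq)
    · linarith [hout q hq]
  have hL := hpos p hpQ
  unfold LstarOp at hL
  have c1 : Continuous (fun z => h (z, p.2)) := by fun_prop
  have c2 : Continuous (fun τ : ℝ => h (p.1, τ)) := by fun_prop
  have e1 : ∑ i ∈ Finset.univ.erase (Fin.last m),
      a i * gLap N i (s i) (fun z => h (z, p.2)) p.1 ≤ 0 :=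
    Finset.sum_nonpos fun i _ => mul_nonpos_of_nonneg_of_nonpos (ha i)
      (gLap_nonpos_aux N i (s i) (hs i).1 _ c1 p.1 fun z => hmin (z, p.2))
  have e2 := mul_nonneg (sub_pos.mpr hν.2).le
    (dirD2_nonneg_aux _ c1 p.1 (eN N) fun z => hmin (z, p.2))
  have e3 := mul_nonneg hν.1.le
    (dirD2_nonneg_aux _ c2 p.2 1 fun z => hmin (p.1, z))
  linarith

end
end

section
/- Let n ≥ 2, m ≥ 2, and N_1, …, N_{m-1} ∈ ℕ with N_1 + … + N_{m-1} = n - 1, and let s ∈ (0,1) and a_1, …, a_{m-1} > 0. Then there exists λ > 0 such that for every unit vector ν ∈ S^{n-2} ⊂ ℝ^{n-1} one has ∫_{S^{n-2}} |ν · θ|^{2s} dμ(θ) ≥ λ. -/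
open MeasureTheory Real Filter

noncomputable section

instance {ι : Type*} [Fintype ι] (N : ι → ℕ) : MeasurableSpace (GS N) := borel _
instance {ι : Type*} [Fintype ι] (N : ι → ℕ) : BorelSpace (GS N) := ⟨rfl⟩

theorem aux_fin (d : ℕ) :
    μH[(d : ℝ)] (Metric.sphere (0 : EuclideanSpace ℝ (Fin (d + 1))) 1) < ⊤ := by
  have key : ∀ v : EuclideanSpace ℝ (Fin (d + 1)), ‖v‖ = 1 →
      μH[(d : ℝ)] ({x ∈ Metric.sphere (0 : EuclideanSpace ℝ (Fin (d + 1))) 1 |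
        (inner ℝ v x : ℝ) ≤ 0}) < ⊤ := by
    intro v hv
    have hv0 : v ≠ 0 := by
      rintro rfl
      simp at hv
    have : Fact (Module.finrank ℝ (EuclideanSpace ℝ (Fin (d + 1))) = d + 1) := ⟨by simp⟩
    have hfr := Submodule.finrank_orthogonal_span_singleton (𝕜 := ℝ) (n := d) hv0
    set g : (Submodule.span ℝ {v})ᗮ → EuclideanSpace ℝ (Fin (d + 1)) :=
      fun w => stereoInvFunAux v (w : EuclideanSpace ℝ (Fin (d + 1))) with hg
    have hgc : ContDiff ℝ 1 g :=
      contDiff_stereoInvFunAux.comp (Submodule.subtypeL (Submodule.span ℝ {v})ᗮ).contDiff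
    have hK : IsCompact (Metric.closedBall (0 : (Submodule.span ℝ {v})ᗮ) 2) :=
      isCompact_closedBall _ _
    obtain ⟨K, hKL⟩ := (hgc.locallyLipschitz.locallyLipschitzOn
      (s := Metric.closedBall (0 : (Submodule.span ℝ {v})ᗮ) 2)).exists_lipschitzOnWith_of_compact hK
    have h1 := hKL.hausdorffMeasure_image_le (d := (d : ℝ)) (by positivity)
    have h2 : μH[(d : ℝ)] (Metric.closedBall (0 : (Submodule.span ℝ {v})ᗮ) 2) < ⊤ := by
      have h := hK.measure_lt_top (μ := μH[(Module.finrank ℝ (Submodule.span ℝ {v})ᗮ : ℝ)])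
      rwa [hfr] at h
    refine lt_of_le_of_lt (measure_mono ?_) (lt_of_le_of_lt h1 ?_)
    · rintro x ⟨hx, hvx⟩
      have hxv : x ≠ v := by
        rintro rfl
        rw [real_inner_self_eq_norm_sq, hv] at hvx
        norm_num at hvx
      refine ⟨stereoToFun v x, ?_, ?_⟩
      · rw [mem_closedBall_zero_iff, stereoToFun_apply, norm_smul]
        have h3 : ‖(Submodule.span ℝ {v})ᗮ.orthogonalProjectionOnto x‖ ≤ 1 := by
          refine (Submodule.norm_orthogonalProjectionOnto_apply_le _ x).trans ?_
          simpa using hx.le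
        have h4 : ‖(2 / ((1 : ℝ) - innerSL ℝ v x))‖ ≤ 2 := by
          rw [innerSL_apply_apply, Real.norm_eq_abs, abs_of_nonneg (by
            apply div_nonneg <;> linarith)]
          rw [div_le_iff₀ (by linarith)]
          linarith
        nlinarith [norm_nonneg ((Submodule.span ℝ {v})ᗮ.orthogonalProjectionOnto x)]
      · have := stereo_left_inv hv (x := ⟨x, hx⟩) hxv
        exact congrArg Subtype.val this
    · exact ENNReal.mul_lt_top (by simp) h2
  set v : EuclideanSpace ℝ (Fin (d + 1)) := EuclideanSpace.single 0 1
  have hv : ‖v‖ = 1 := by simp [v]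
  refine lt_of_le_of_lt (measure_mono ?_) (lt_of_le_of_lt (measure_union_le _ _)
    (ENNReal.add_lt_top.2 ⟨key v hv, key (-v) (by simpa using hv)⟩))
  intro x hx
  rcases le_total (inner ℝ v x : ℝ) 0 with h | h
  · exact Or.inl ⟨hx, h⟩
  · exact Or.inr ⟨hx, by simpa [inner_neg_left] using h⟩

theorem aux_pos (d : ℕ) (v : EuclideanSpace ℝ (Fin (d + 1))) (hv0 : v ≠ 0) :
    0 < μH[(d : ℝ)] ({x ∈ Metric.sphere (0 : EuclideanSpace ℝ (Fin (d + 1))) 1 |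
        (inner ℝ v x : ℝ) ≠ 0}) := by
  have : Fact (Module.finrank ℝ (EuclideanSpace ℝ (Fin (d + 1))) = d + 1) := ⟨by simp⟩
  have hfr := Submodule.finrank_orthogonal_span_singleton (𝕜 := ℝ) (n := d) hv0
  set P := (Submodule.span ℝ {v})ᗮ.orthogonalProjectionOnto with hP
  have hL : LipschitzWith 1 P := by
    refine LipschitzWith.of_dist_le_mul fun x y => ?_
    rw [dist_eq_norm, dist_eq_norm, ← map_sub, NNReal.coe_one, one_mul]
    exact Submodule.norm_orthogonalProjectionOnto_apply_le _ _
  have h1 := hL.hausdorffMeasure_image_le (d := (d : ℝ)) (by positivity)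
    ({x ∈ Metric.sphere (0 : EuclideanSpace ℝ (Fin (d + 1))) 1 | (inner ℝ v x : ℝ) ≠ 0})
  have h2 : 0 < μH[(d : ℝ)] (Metric.ball (0 : (Submodule.span ℝ {v})ᗮ) 1) := by
    have h := Metric.measure_ball_pos (μH[(Module.finrank ℝ (Submodule.span ℝ {v})ᗮ : ℝ)])
      (0 : (Submodule.span ℝ {v})ᗮ) one_pos
    rwa [hfr] at h
  have hnv : 0 < ‖v‖ := norm_pos_iff.2 hv0
  have h3 : Metric.ball (0 : (Submodule.span ℝ {v})ᗮ) 1 ⊆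
      P '' ({x ∈ Metric.sphere (0 : EuclideanSpace ℝ (Fin (d + 1))) 1 |
        (inner ℝ v x : ℝ) ≠ 0}) := by
    intro w hw
    rw [mem_ball_zero_iff] at hw
    have hpos : 0 < 1 - ‖w‖ ^ 2 := by nlinarith [norm_nonneg w]
    set c : ℝ := √(1 - ‖w‖ ^ 2) / ‖v‖ with hc
    have hcpos : 0 < c := div_pos (Real.sqrt_pos.2 hpos) hnv
    have hwv : (inner ℝ v (w : EuclideanSpace ℝ (Fin (d + 1))) : ℝ) = 0 :=
      Submodule.mem_orthogonal_singleton_iff_inner_right.1 w.2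
    have hcv : (c * ‖v‖) ^ 2 = 1 - ‖w‖ ^ 2 := by
      rw [hc, div_mul_cancel₀ _ hnv.ne', Real.sq_sqrt hpos.le]
    refine ⟨(w : EuclideanSpace ℝ (Fin (d + 1))) + c • v, ⟨?_, ?_⟩, ?_⟩
    · rw [mem_sphere_zero_iff_norm]
      have : ‖(w : EuclideanSpace ℝ (Fin (d + 1))) + c • v‖ ^ 2 = 1 := by
        rw [norm_add_sq_real, inner_smul_right, real_inner_comm, hwv, norm_smul, mul_pow,
          Real.norm_eq_abs, sq_abs, ← mul_pow, hcv, Submodule.coe_norm]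
        ring
      nlinarith [norm_nonneg ((w : EuclideanSpace ℝ (Fin (d + 1))) + c • v)]
    · rw [inner_add_right, hwv, inner_smul_right, real_inner_self_eq_norm_sq]
      positivity
    · rw [map_add, map_smul, hP, Submodule.orthogonalProjectionOnto_mem_subspace_eq_self,
        Submodule.orthogonalProjectionOnto_orthogonalComplement_singleton_eq_zero]
      simp
  have h4 := h2.trans_le (measure_mono h3)
  have h5 := h4.trans_le h1
  simpa using h5

theorem aux_norm {ι : Type*} [Fintype ι] [DecidableEq ι] (N : ι → ℕ) (i : ι)
    (y : EuclideanSpace ℝ (Fin (N i))) : ‖grpIncl N i y‖ = ‖y‖ :=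
  PiLp.norm_single 2 (fun i : ι => EuclideanSpace ℝ (Fin (N i))) i y

theorem aux_pos2 (M : ℕ) (v : EuclideanSpace ℝ (Fin M)) (hv0 : v ≠ 0) :
    0 < μH[(M : ℝ) - 1] ({x ∈ Metric.sphere (0 : EuclideanSpace ℝ (Fin M)) 1 |
        (inner ℝ v x : ℝ) ≠ 0}) := by
  rcases M with _ | d
  · exact absurd (Subsingleton.elim v 0) hv0
  · have := aux_pos d v hv0
    simpa using this

theorem aux_iso {ι : Type*} [Fintype ι] [DecidableEq ι] (N : ι → ℕ) (i : ι) :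
    Isometry (grpIncl N i) := by
  refine Isometry.of_dist_eq fun x y => ?_
  rw [dist_eq_norm, dist_eq_norm]
  have : grpIncl N i x - grpIncl N i y = grpIncl N i (x - y) := by
    unfold grpIncl
    rw [← WithLp.toLp_sub, Pi.single_sub]
  rw [this, aux_norm]

theorem aux_inner {ι : Type*} [Fintype ι] [DecidableEq ι] (N : ι → ℕ) (i : ι) (ν : GS N)
    (y : EuclideanSpace ℝ (Fin (N i))) :
    (inner ℝ ν (grpIncl N i y) : ℝ) = inner ℝ (ν i) y := by
  rw [PiLp.inner_apply, Finset.sum_eq_single i]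
  · simp [grpIncl]
  · intro j _ hj
    simp [grpIncl, Pi.single_eq_of_ne hj]
  · simp

theorem aux_cns (N : ℕ) (s : ℝ) (hs : s ∈ Set.Ioo (0 : ℝ) 1) : 0 < cns N s := by
  have h1 : Real.Gamma (-s) ≠ 0 := by
    apply Real.Gamma_ne_zero
    intro m hm
    have h : s = m := by linarith
    rcases Nat.eq_zero_or_pos m with h0 | h0
    · subst h0
      simp at h
      linarith [hs.1]
    · have : (1 : ℝ) ≤ m := by exact_mod_cast h0
      linarith [hs.2]
  have h2 : 0 < Real.Gamma (s + (N : ℝ) / 2) := by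
    apply Real.Gamma_pos_of_pos
    have := hs.1
    positivity
  have := abs_pos.2 h1
  unfold cns
  positivity

theorem aux_fin' {ι : Type*} [Fintype ι] [DecidableEq ι] (N : ι → ℕ) (i : ι) :
    μH[(N i : ℝ) - 1]
      (grpIncl N i '' Metric.sphere (0 : EuclideanSpace ℝ (Fin (N i))) 1) < ⊤ := by
  rcases Nat.eq_zero_or_pos (N i) with h | h
  · have : Metric.sphere (0 : EuclideanSpace ℝ (Fin (N i))) 1 = ∅ := by
      rw [h]
      ext x
      simp [Subsingleton.elim x 0]
    simp [this]
  · obtain ⟨d, hd⟩ : ∃ d, N i = d + 1 := ⟨N i - 1, by omega⟩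
    rw [(aux_iso N i).hausdorffMeasure_image, hd]
    · have := aux_fin d
      simpa using this
    · left
      rw [hd]
      simp

theorem aux_pos' {ι : Type*} [Fintype ι] [DecidableEq ι] (N : ι → ℕ) (i : ι)
    (ν : GS N) (hν : ν i ≠ 0) :
    0 < μH[(N i : ℝ) - 1]
      (grpIncl N i '' {x ∈ Metric.sphere (0 : EuclideanSpace ℝ (Fin (N i))) 1 |
        (inner ℝ (ν i) x : ℝ) ≠ 0}) := by
  have hN : N i ≠ 0 := by
    intro h
    apply hν
    ext j
    exact absurd j.2 (by omega)
  have hN1 : (1 : ℝ) ≤ N i := by exact_mod_cast Nat.one_le_iff_ne_zero.2 hN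
  rw [(aux_iso N i).hausdorffMeasure_image (Or.inl (by linarith))]
  exact aux_pos2 (N i) (ν i) hν

/-- formula (3.2): the spherical measure
`μ = Σ_i (a_i c_{N_i,s}/2) ℋ_i` satisfies a uniform ellipticity bound
`∫ |ν·θ|^{2s} dμ(θ) ≥ λ > 0` over unit vectors `ν`. -/
theorem stmt15 (n : ℕ) (hn : 2 ≤ n) (k : ℕ) (hk : 1 ≤ k)
    (N : Fin k → ℕ) (hNsum : (∑ i, N i) = n - 1)
    (s : ℝ) (hs : s ∈ Set.Ioo (0 : ℝ) 1)
    (a : Fin k → ℝ) (ha : ∀ i, 0 < a i) :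
    ∃ lam > 0, ∀ ν : GS N, ‖ν‖ = 1 →
      lam ≤ ∑ i : Fin k, (a i * cns (N i) s / 2) *
        ∫ θ in (grpIncl N i '' Metric.sphere (0 : EuclideanSpace ℝ (Fin (N i))) 1),
          |(inner ℝ ν θ : ℝ)| ^ (2 * s) ∂(μH[(N i : ℝ) - 1]) := by
  classical
  obtain ⟨hs0, hs1⟩ := hs
  have hS : ∀ i, IsCompact
      (grpIncl N i '' Metric.sphere (0 : EuclideanSpace ℝ (Fin (N i))) 1) := fun i =>
    (isCompact_sphere _ _).image (aux_iso N i).continuous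
  have hnorm : ∀ i, ∀ θ ∈ grpIncl N i '' Metric.sphere (0 : EuclideanSpace ℝ (Fin (N i))) 1,
      ‖θ‖ = 1 := by
    rintro i _ ⟨y, hy, rfl⟩
    rw [aux_norm]
    simpa using hy
  have hbd : ∀ i, ∀ ν ∈ Metric.sphere (0 : GS N) 1,
      ∀ θ ∈ grpIncl N i '' Metric.sphere (0 : EuclideanSpace ℝ (Fin (N i))) 1,
      ‖|(inner ℝ ν θ : ℝ)| ^ (2 * s)‖ ≤ 1 := by
    intro i ν hν θ hθ
    have h1 := abs_real_inner_le_norm ν θ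
    rw [hnorm i θ hθ, mem_sphere_zero_iff_norm.1 hν, mul_one] at h1
    rw [Real.norm_eq_abs, abs_of_nonneg (by positivity)]
    exact Real.rpow_le_one (abs_nonneg _) h1 (by positivity)
  have hcont1 : ∀ ν : GS N, Continuous fun θ : GS N => |(inner ℝ ν θ : ℝ)| ^ (2 * s) := by
    intro ν
    exact (continuous_const.inner continuous_id).abs.rpow_const (fun _ => Or.inr (by positivity))
  have hcont2 : ∀ θ : GS N, Continuous fun ν : GS N => |(inner ℝ ν θ : ℝ)| ^ (2 * s) := by
    intro θ
    exact (continuous_id.inner continuous_const).abs.rpow_const (fun _ => Or.inr (by positivity))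
  have hfinm : ∀ i, IsFiniteMeasure ((μH[(N i : ℝ) - 1]).restrict
      (grpIncl N i '' Metric.sphere (0 : EuclideanSpace ℝ (Fin (N i))) 1)) := fun i =>
    ⟨by rw [Measure.restrict_apply_univ]; exact aux_fin' N i⟩
  have hae : ∀ i, ∀ ν ∈ Metric.sphere (0 : GS N) 1, ∀ᵐ θ ∂((μH[(N i : ℝ) - 1]).restrict
      (grpIncl N i '' Metric.sphere (0 : EuclideanSpace ℝ (Fin (N i))) 1)),
      ‖|(inner ℝ ν θ : ℝ)| ^ (2 * s)‖ ≤ 1 := fun i ν hν =>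
    (ae_restrict_iff' (hS i).measurableSet).2 (Eventually.of_forall fun θ hθ => hbd i ν hν θ hθ)
  set F : GS N → ℝ := fun ν => ∑ i : Fin k, (a i * cns (N i) s / 2) *
        ∫ θ in (grpIncl N i '' Metric.sphere (0 : EuclideanSpace ℝ (Fin (N i))) 1),
          |(inner ℝ ν θ : ℝ)| ^ (2 * s) ∂(μH[(N i : ℝ) - 1]) with hF
  have hFc : ContinuousOn F (Metric.sphere 0 1) := by
    refine continuousOn_finsetSum _ fun i _ => ContinuousOn.mul continuousOn_const ?_
    have := hfinm i
    refine continuousOn_of_dominated (bound := fun _ => (1 : ℝ)) ?_ (hae i) ?_ ?_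
    · intro ν _
      exact (hcont1 ν).aestronglyMeasurable
    · exact integrable_const _
    · exact Eventually.of_forall fun θ => (hcont2 θ).continuousOn
  have hFpos : ∀ ν ∈ Metric.sphere (0 : GS N) 1, 0 < F ν := by
    intro ν hν
    have hν0 : ν ≠ 0 := by
      rintro rfl
      simp at hν
    obtain ⟨i, hi⟩ : ∃ i, ν i ≠ 0 := by
      by_contra! h
      apply hν0
      ext i : 1
      exact h i
    have hc : ∀ i, 0 < a i * cns (N i) s / 2 := fun i => by
      have := aux_cns (N i) s ⟨hs0, hs1⟩
      have := ha i
      positivity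
    refine Finset.sum_pos' (fun j _ => mul_nonneg (hc j).le
      (integral_nonneg fun θ => by positivity)) ⟨i, Finset.mem_univ _, mul_pos (hc i) ?_⟩
    have := hfinm i
    rw [setIntegral_pos_iff_support_of_nonneg_ae
      (Eventually.of_forall fun θ => by positivity)]
    · refine (aux_pos' N i ν hi).trans_le (measure_mono ?_)
      rintro _ ⟨y, ⟨hy, hne⟩, rfl⟩
      refine ⟨?_, ⟨y, hy, rfl⟩⟩
      rw [Function.mem_support, aux_inner]
      exact (Real.rpow_pos_of_pos (abs_pos.2 hne) _).ne'
    · exact Integrable.of_bound (hcont1 ν).aestronglyMeasurable 1 (hae i ν hν)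
  rcases (Metric.sphere (0 : GS N) 1).eq_empty_or_nonempty with he | hne
  · refine ⟨1, one_pos, fun ν hν => ?_⟩
    have : ν ∈ Metric.sphere (0 : GS N) 1 := by simpa using hν
    rw [he] at this
    exact this.elim
  · obtain ⟨ν₀, hν₀, hmin⟩ := (isCompact_sphere (0 : GS N) 1).exists_isMinOn hne hFc
    exact ⟨F ν₀, hFpos ν₀ hν₀, fun ν hν => hmin (by simpa using hν : ν ∈ Metric.sphere (0 : GS N) 1)⟩

end
end
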